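/- Divergence-free Schwartz-class vector fields are dense in D with respect to the graph norm ‖φ‖_D := ‖Lφ‖_X: for every φ ∈ D there exists a sequence (φ_n) of divergence-free vector fields in the Schwartz class S(ℝ³;ℝ³) such that ‖L(φ_n − φ)‖_X → 0 as n → ∞ (and consequently φ_n → φ in X). -/

import Mathlib

noncomputable section

open MeasureTheory Real Set Filter Topology

abbrev V3 : Type := Fin 3 → ℝ
abbrev VF : Type := V3 → Fin 3 → ℝ
abbrev VFC : Type := V3 → Fin 3 → ℂ

/-- Classical partial derivative of a scalar function on `ℝ³`. -/
def pd (j : Fin 3) (f : V3 → ℝ) (x : V3) : ℝ := fderiv ℝ f x (Pi.single j 1)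

/-- Classical partial derivative of the `i`-th component of a vector field. -/
def pdv (j : Fin 3) (f : VF) (i : Fin 3) (x : V3) : ℝ := pd j (fun y => f y i) x

def pdv2 (j k : Fin 3) (f : VF) (i : Fin 3) (x : V3) : ℝ := pd j (fun y => pdv k f i y) x

def lap (f : V3 → ℝ) (x : V3) : ℝ := ∑ j, pd j (fun y => pd j f y) x

def lapv (f : VF) (i : Fin 3) (x : V3) : ℝ := lap (fun y => f y i) x

/-- Smooth compactly supported scalar test function. -/
def TestS (ψ : V3 → ℝ) : Prop := ContDiff ℝ (⊤ : ℕ∞) ψ ∧ HasCompactSupport ψ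

/-- Smooth compactly supported divergence-free vector test field. -/
def TestV (ψ : VF) : Prop :=
  ContDiff ℝ (⊤ : ℕ∞) ψ ∧ HasCompactSupport ψ ∧ ∀ x, ∑ i, pdv i ψ i x = 0

/-- Divergence-free in the sense of distributions. -/
def WeakDivFree (u : VF) : Prop :=
  ∀ ψ : V3 → ℝ, TestS ψ → ∫ x : V3, ∑ i, u x i * pd i ψ x = 0

def MemL24 (u : VF) : Prop := MemLp u 2 volume ∧ MemLp u 4 volume

def Xnorm (u : VF) : ℝ := (eLpNorm u 2 volume).toReal + (eLpNorm u 4 volume).toReal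

def L2norm (u : VF) : ℝ := (eLpNorm u 2 volume).toReal
def L4norm (u : VF) : ℝ := (eLpNorm u 4 volume).toReal
def LinfNorm (u : VF) : ℝ := (eLpNorm u ⊤ volume).toReal

/-- Membership in the space `X = L² ∩ L⁴` divergence free. -/
def InX (u : VF) : Prop := MemL24 u ∧ WeakDivFree u

def gradFn (u : VF) (x : V3) : Fin 3 × Fin 3 → ℝ := fun p => pdv p.1 u p.2 x
def hessFn (u : VF) (x : V3) : Fin 3 × Fin 3 × Fin 3 → ℝ := fun p => pdv2 p.1 p.2.1 u p.2.2 x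

def XDnorm (u : VF) : ℝ :=
  (eLpNorm (gradFn u) 2 volume).toReal + (eLpNorm (gradFn u) 4 volume).toReal
def X2norm (u : VF) : ℝ :=
  (eLpNorm (hessFn u) 2 volume).toReal + (eLpNorm (hessFn u) 4 volume).toReal
def D2norm (u : VF) : ℝ := (eLpNorm (gradFn u) 2 volume).toReal
def D4norm (u : VF) : ℝ := (eLpNorm (gradFn u) 4 volume).toReal
def DinfNorm (u : VF) : ℝ := (eLpNorm (gradFn u) ⊤ volume).toReal

/-- `g` is the weak partial derivative `∂ⱼ u`. -/
def IsWD1 (j : Fin 3) (u g : VF) : Prop :=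
  ∀ i ψ, TestS ψ → ∫ x : V3, g x i * ψ x = - ∫ x : V3, u x i * pd j ψ x

/-- `g` is the weak second derivative `∂ⱼ∂ₖ u`. -/
def IsWD2 (j k : Fin 3) (u g : VF) : Prop :=
  ∀ i ψ, TestS ψ → ∫ x : V3, g x i * ψ x = ∫ x : V3, u x i * pd j (fun y => pd k ψ y) x

/-- `g` is the weak derivative `x·∇u`. -/
def IsWXD (u g : VF) : Prop :=
  ∀ i ψ, TestS ψ →
    ∫ x : V3, g x i * ψ x = - ∫ x : V3, u x i * (3 * ψ x + ∑ j, x j * pd j ψ x)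

/-- Membership in the domain `D` of the operator `L`. -/
def InD (u : VF) : Prop :=
  InX u ∧ (∀ j, ∃ g, MemL24 g ∧ IsWD1 j u g)
    ∧ (∀ j k, ∃ g, MemL24 g ∧ IsWD2 j k u g)
    ∧ (∃ g, MemL24 g ∧ IsWXD u g)

/-- Weak (distributional) characterization of `g = Lu := Δu + (x/2)·∇u + u/2`. -/
def IsLof (u g : VF) : Prop :=
  ∀ i ψ, TestS ψ →
    ∫ x : V3, g x i * ψ x
      = ∫ x : V3, u x i * (lap ψ x - (∑ j, x j / 2 * pd j ψ x) - ψ x)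

def YBound (a : VF) (M : ℝ) : Prop :=
  ∀ x, (1 + ‖x‖) * ‖a x‖ ≤ M ∧ (1 + ‖x‖) ^ 2 * ‖gradFn a x‖ ≤ M ∧
    (1 + ‖x‖) ^ 3 * ‖hessFn a x‖ ≤ M

/-- Membership in the space `Y` of decaying divergence free fields. -/
def InY (a : VF) : Prop :=
  ContDiff ℝ 2 a ∧ (∀ x, ∑ i, pdv i a i x = 0) ∧ ∃ M, YBound a M

def ptd (f : ℝ × V3 → ℝ) (p : ℝ × V3) : ℝ := fderiv ℝ f p ((1 : ℝ), (0 : V3))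
def pxd (j : Fin 3) (f : ℝ × V3 → ℝ) (p : ℝ × V3) : ℝ :=
  fderiv ℝ f p ((0 : ℝ), Pi.single j (1 : ℝ))
def lapxd (f : ℝ × V3 → ℝ) (p : ℝ × V3) : ℝ := ∑ j, pxd j (fun q => pxd j f q) p

/-- Space-time test fields, compactly supported in time inside `I`, divergence free in `x`. -/
def TestST (I : Set ℝ) (ψ : ℝ × V3 → Fin 3 → ℝ) : Prop :=
  ContDiff ℝ (⊤ : ℕ∞) ψ ∧ HasCompactSupport ψ ∧ tsupport ψ ⊆ {p : ℝ × V3 | p.1 ∈ I} ∧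
  ∀ p, ∑ i, pxd i (fun q => ψ q i) p = 0

/-- Weak (distributional, modulo a pressure gradient) formulation of
`∂ₜφ = Δφ + (x/2)·∇φ + φ/2 − a·∇φ − φ·∇a + ∇p` on `I × ℝ³`. -/
def WeakDriftSol (a : VF) (I : Set ℝ) (φ : ℝ → VF) : Prop :=
  ∀ ψ : ℝ × V3 → Fin 3 → ℝ, TestST I ψ →
    (∫ t in I, ∫ x : V3, ∑ i,
      (φ t x i * ptd (fun q => ψ q i) (t, x)
        + φ t x i * lapxd (fun q => ψ q i) (t, x)
        - φ t x i * ((∑ j, x j / 2 * pxd j (fun q => ψ q i) (t, x)) + ψ (t, x) i)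
        + φ t x i * (∑ j, a x j * pxd j (fun q => ψ q i) (t, x))
        - (∑ j, φ t x j * pdv j a i x) * ψ (t, x) i)) = 0

def Dtv (φ : ℝ → VF) (t : ℝ) (x : V3) (i : Fin 3) : ℝ := deriv (fun s => φ s x i) t

def SgClass (φ : ℝ → VF) : Prop :=
  (∀ t ∈ Ioi (0:ℝ), MemL24 (φ t) ∧ WeakDivFree (φ t)) ∧
  (∀ T, 0 < T → ∃ C, ∀ t ∈ Ioo (0:ℝ) T, Xnorm (φ t) + t * X2norm (φ t) ≤ C)

/-- `φ` is the semigroup solution `S_a(t)φ₀`. -/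
def IsSgSol (a : VF) (φ₀ : VF) (φ : ℝ → VF) : Prop :=
  SgClass φ ∧ WeakDriftSol a (Ioi 0) φ ∧
  Tendsto (fun t => Xnorm (fun x i => φ t x i - φ₀ x i)) (nhdsWithin 0 (Ioi 0)) (nhds 0)

def MemL24C (u : VFC) : Prop := MemLp u 2 volume ∧ MemLp u 4 volume
def XnormC (u : VFC) : ℝ := (eLpNorm u 2 volume).toReal + (eLpNorm u 4 volume).toReal
def WeakDivFreeC (u : VFC) : Prop :=
  ∀ ψ : V3 → ℝ, TestS ψ → ∫ x : V3, ∑ i, u x i * (pd i ψ x : ℂ) = 0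
def IsWD1C (j : Fin 3) (u g : VFC) : Prop :=
  ∀ i ψ, TestS ψ →
    ∫ x : V3, g x i * (ψ x : ℂ) = - ∫ x : V3, u x i * (pd j ψ x : ℂ)
def IsWD2C (j k : Fin 3) (u g : VFC) : Prop :=
  ∀ i ψ, TestS ψ →
    ∫ x : V3, g x i * (ψ x : ℂ) = ∫ x : V3, u x i * (pd j (fun y => pd k ψ y) x : ℂ)
def IsWXDC (u g : VFC) : Prop :=
  ∀ i ψ, TestS ψ →
    ∫ x : V3, g x i * (ψ x : ℂ)
      = - ∫ x : V3, u x i * ((3 * ψ x + ∑ j, x j * pd j ψ x : ℝ) : ℂ)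
def InXC (u : VFC) : Prop := MemL24C u ∧ WeakDivFreeC u
def InDC (u : VFC) : Prop :=
  InXC u ∧ (∀ j, ∃ g, MemL24C g ∧ IsWD1C j u g)
    ∧ (∀ j k, ∃ g, MemL24C g ∧ IsWD2C j k u g)
    ∧ (∃ g, MemL24C g ∧ IsWXDC u g)

/-- `φ` is a (complex) eigenfunction of `L − K(a)` with eigenvalue `lam`,
in the weak sense (tested against divergence free test fields, which kills `∇p`). -/
def EigFun (a : VF) (lam : ℂ) (φ : VFC) : Prop :=
  InDC φ ∧
  ∀ ψ : VF, TestV ψ →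
    (∫ x : V3, ((∑ i, φ x i *
        ((lapv ψ i x - (∑ j, x j / 2 * pdv j ψ i x) - ψ x i
          + ∑ j, a x j * pdv j ψ i x : ℝ) : ℂ))
      - ∑ i, (∑ j, φ x j * ((pdv j a i x : ℝ) : ℂ)) * ((ψ x i : ℝ) : ℂ)))
    = lam * ∫ x : V3, ∑ i, φ x i * ((ψ x i : ℝ) : ℂ)

def IsEig (a : VF) (lam : ℂ) : Prop :=
  ∃ φ : VFC, EigFun a lam φ ∧ ¬ φ =ᵐ[volume] (0 : VFC)

def SimpleEig (a : VF) (lam : ℂ) : Prop :=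
  IsEig a lam ∧ ∀ φ φ' : VFC, EigFun a lam φ → EigFun a lam φ' →
    ∃ c c' : ℂ, ¬ (c = 0 ∧ c' = 0) ∧
      (fun x i => c * φ x i + c' * φ' x i) =ᵐ[volume] (0 : VFC)

/-- Weak formulation of `(L − K(a))φ = F` modulo a pressure gradient. -/
def WeakLKeq (a : VF) (φ F : VF) : Prop :=
  ∀ ψ : VF, TestV ψ →
    (∫ x : V3, ((∑ i, φ x i * (lapv ψ i x - (∑ j, x j / 2 * pdv j ψ i x) - ψ x i
          + ∑ j, a x j * pdv j ψ i x))
        - ∑ i, (∑ j, φ x j * pdv j a i x) * ψ x i))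
      = ∫ x : V3, ∑ i, F x i * ψ x i

def heatKer (t : ℝ) (z : V3) : ℝ :=
  (4 * Real.pi * t) ^ (-(3:ℝ)/2) * Real.exp (-‖z‖ ^ 2 / (4 * t))

def heatFlow (u : VF) (t : ℝ) (x : V3) : Fin 3 → ℝ :=
  fun i => ∫ y : V3, heatKer t (x - y) * u y i

/-- Heat flow at time `1`, i.e. `e^{Δ}u`. -/
def heatU (u : VF) : VF := fun x => heatFlow u 1 x

def DivFreePt (U : VF) : Prop := ∀ x, ∑ i, pdv i U i x = 0

/-- `U` is a smooth self-similar profile with data `σ u₀`: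
`ΔU + (x/2)·∇U + U/2 − U·∇U + ∇P = 0` with decay `|∇^α(U − σ e^Δ u₀)| ≲ (1+|x|)^{−3−|α|}`. -/
def IsProfile (u₀ : VF) (σ : ℝ) (U : VF) : Prop :=
  ContDiff ℝ (⊤ : ℕ∞) U ∧ DivFreePt U ∧
  (∃ P : V3 → ℝ, ContDiff ℝ (⊤ : ℕ∞) P ∧ ∀ x i,
    lapv U i x + (∑ j, x j / 2 * pdv j U i x) + U x i / 2
      - (∑ j, U x j * pdv j U i x) + pd i P x = 0) ∧
  ∀ n : ℕ, ∃ C : ℝ, ∀ x,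
    ‖iteratedFDeriv ℝ n (fun y => (fun i => U y i - σ * heatU u₀ y i)) x‖
      ≤ C * (1 + ‖x‖) ^ (-(3:ℝ) - (n : ℝ))

/-- `u₀` is smooth away from the origin, `(−1)`-homogeneous and divergence free. -/
def HomogData (u₀ : VF) : Prop :=
  ContDiffOn ℝ (⊤ : ℕ∞) u₀ {(0 : V3)}ᶜ ∧
  (∀ l : ℝ, 0 < l → ∀ x : V3, x ≠ 0 → u₀ (l • x) = fun i => l⁻¹ * u₀ x i) ∧
  (∀ x : V3, x ≠ 0 → ∑ i, pdv i u₀ i x = 0)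

/-- Spectral condition (A). -/
def SpecA (u₀ : VF) (Usig : ℝ → VF) (σ₀ δ : ℝ) (lam1 : ℝ → ℂ) : Prop :=
  HomogData u₀ ∧ 0 < δ ∧
  (∀ σ ≤ σ₀, IsProfile u₀ σ (Usig σ)) ∧
  Continuous (fun p : ℝ × V3 => Usig p.1 p.2) ∧
  ContDiff ℝ 1 lam1 ∧
  (∀ σ ≤ σ₀, SimpleEig (Usig σ) (lam1 σ) ∧
    ∀ lam : ℂ, IsEig (Usig σ) lam →
      lam.re < -δ ∨ lam = lam1 σ ∨ lam = starRingEnd ℂ (lam1 σ)) ∧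
  (∀ σ < σ₀, (lam1 σ).re < 0) ∧
  (lam1 σ₀).re = 0 ∧ 0 < (lam1 σ₀).im ∧
  0 < deriv (fun σ => (lam1 σ).re) σ₀

/-- Spectral condition (B). -/
def SpecB (u₀ : VF) (Usig : ℝ → VF) (σ₀ δ : ℝ) (lam1 : ℝ → ℝ) : Prop :=
  HomogData u₀ ∧ 0 < δ ∧
  (∀ σ ≤ σ₀, IsProfile u₀ σ (Usig σ)) ∧
  Continuous (fun p : ℝ × V3 => Usig p.1 p.2) ∧
  Continuous lam1 ∧
  (∀ σ ≤ σ₀, SimpleEig (Usig σ) ((lam1 σ : ℝ) : ℂ) ∧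
    ∀ lam : ℂ, IsEig (Usig σ) lam → lam.re < -δ ∨ lam = ((lam1 σ : ℝ) : ℂ)) ∧
  (∀ σ < σ₀, lam1 σ < 0) ∧ lam1 σ₀ = 0

/-- Weak formulation of the ancient perturbation equation
`∂ₜφ = Δφ + (x/2)·∇φ + φ/2 − U·∇φ − φ·∇U − φ·∇φ + ∇p` on `ℝ³ × (−∞,0)`. -/
def WeakAncient (U : VF) (φ : ℝ → VF) : Prop :=
  ∀ ψ : ℝ × V3 → Fin 3 → ℝ, TestST (Iio 0) ψ →
    (∫ t in Iio (0:ℝ), ∫ x : V3, ∑ i,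
      (φ t x i * ptd (fun q => ψ q i) (t, x)
        + φ t x i * lapxd (fun q => ψ q i) (t, x)
        - φ t x i * ((∑ j, x j / 2 * pxd j (fun q => ψ q i) (t, x)) + ψ (t, x) i)
        + φ t x i * (∑ j, U x j * pxd j (fun q => ψ q i) (t, x))
        - (∑ j, φ t x j * pdv j U i x) * ψ (t, x) i
        + φ t x i * (∑ j, φ t x j * pxd j (fun q => ψ q i) (t, x)))) = 0

/-- Test field for the Leray-Hopf formulation: supported in `ℝ³ × [0,T)`. -/
def TestNSE (T : ℝ) (ψ : ℝ × V3 → Fin 3 → ℝ) : Prop :=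
  ContDiff ℝ (⊤ : ℕ∞) ψ ∧ HasCompactSupport ψ ∧ tsupport ψ ⊆ {p : ℝ × V3 | p.1 < T} ∧
  ∀ p, ∑ i, pxd i (fun q => ψ q i) p = 0

/-- Leray-Hopf weak solution of the Navier-Stokes equations on `ℝ³ × (0,T)`. -/
def IsLerayHopf (T : ℝ) (v₀ : VF) (u : ℝ → VF) : Prop :=
  (∀ t ∈ Ioo (0:ℝ) T, MemLp (u t) 2 volume ∧ WeakDivFree (u t)
      ∧ MemLp (gradFn (u t)) 2 volume) ∧
  (∃ C, ∀ t ∈ Ioo (0:ℝ) T, L2norm (u t) ≤ C) ∧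
  IntegrableOn (fun t => (D2norm (u t)) ^ 2) (Ioo 0 T) volume ∧
  (∀ ψ, TestNSE T ψ →
    (∫ t in Ioo (0:ℝ) T, ∫ x : V3, ∑ i,
      (- u t x i * ptd (fun q => ψ q i) (t, x)
        + (∑ j, pdv j (u t) i x * pxd j (fun q => ψ q i) (t, x))
        + (∑ j, u t x j * pdv j (u t) i x) * ψ (t, x) i))
      = ∫ x : V3, ∑ i, v₀ x i * ψ ((0:ℝ), x) i) ∧
  (∀ᵐ t ∂(volume : Measure ℝ), t ∈ Ioo (0:ℝ) T →
    L2norm (u t) ^ 2 + 2 * (∫ s in Ioo (0:ℝ) t, (D2norm (u s)) ^ 2) ≤ L2norm v₀ ^ 2)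

/-- Compactly supported initial data, smooth outside the origin with `O(1/|x|)` singularity. -/
def GoodV0 (v₀ : VF) : Prop :=
  HasCompactSupport v₀ ∧ ContDiffOn ℝ (⊤ : ℕ∞) v₀ {(0 : V3)}ᶜ ∧ WeakDivFree v₀ ∧
  MemLp v₀ 2 volume ∧
  ∃ C r : ℝ, 0 < r ∧ ∀ x : V3, x ≠ 0 → ‖x‖ < r → ‖v₀ x‖ ≤ C / ‖x‖

def scaled (t : ℝ) (x : V3) : V3 := fun k => x k / Real.sqrt t

/-- The class `Z_T`. -/
def InZT (T : ℝ) (u : ℝ → VF) : Prop :=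
  (∀ t ∈ Ioo (0:ℝ) T, MemLp (u t) 4 volume) ∧
  (∃ C, ∀ t ∈ Ioo (0:ℝ) T, L4norm (u t) + Real.sqrt t * D4norm (u t) ≤ C) ∧
  Tendsto (fun t => Real.sqrt t * D4norm (u t)) (nhdsWithin 0 (Ioi 0)) (nhds 0)

/-- Weak formulation of the Stokes system with singular lower order terms
`∂ₜu − Δu + ã·∇u + u·∇ã + ∇p = f` on `ℝ³ × (0,T)`, `ã(x,t) = t^{-1/2} a(x/√t)`. -/
def WeakSingStokes (a : VF) (f : ℝ → VF) (T : ℝ) (u : ℝ → VF) : Prop :=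
  ∀ ψ : ℝ × V3 → Fin 3 → ℝ, TestST (Ioo 0 T) ψ →
    (∫ t in Ioo (0:ℝ) T, ∫ x : V3, ∑ i,
      (u t x i * ptd (fun q => ψ q i) (t, x)
        + u t x i * lapxd (fun q => ψ q i) (t, x)
        + u t x i * (∑ j, (a (scaled t x) j / Real.sqrt t) * pxd j (fun q => ψ q i) (t, x))
        - (∑ j, u t x j * (pdv j a i (scaled t x) / t)) * ψ (t, x) i
        + f t x i * ψ (t, x) i)) = 0

/-- Weak formulation of the generalized Navier-Stokes system with singular lower
order terms `∂ₜu − Δu + ã·∇u + u·∇ã + b̃·∇u + u·∇b̃ + u·∇u + ∇p = 0`. -/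
def WeakSingNS (a : VF) (b : ℝ → VF) (T : ℝ) (u : ℝ → VF) : Prop :=
  ∀ ψ : ℝ × V3 → Fin 3 → ℝ, TestST (Ioo 0 T) ψ →
    (∫ t in Ioo (0:ℝ) T, ∫ x : V3, ∑ i,
      (u t x i * ptd (fun q => ψ q i) (t, x)
        + u t x i * lapxd (fun q => ψ q i) (t, x)
        + u t x i * (∑ j, (a (scaled t x) j / Real.sqrt t) * pxd j (fun q => ψ q i) (t, x))
        - (∑ j, u t x j * (pdv j a i (scaled t x) / t)) * ψ (t, x) i
        + u t x i * (∑ j, (b (Real.log t) (scaled t x) j / Real.sqrt t)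
              * pxd j (fun q => ψ q i) (t, x))
        + (b (Real.log t) (scaled t x) i / Real.sqrt t)
            * (∑ j, u t x j * pxd j (fun q => ψ q i) (t, x))
        + u t x i * (∑ j, u t x j * pxd j (fun q => ψ q i) (t, x)))) = 0

/-- Weak (interior) formulation of the Navier-Stokes equations on `ℝ³ × (0,T)`. -/
def WeakNSEInterior (T : ℝ) (u : ℝ → VF) : Prop :=
  ∀ ψ : ℝ × V3 → Fin 3 → ℝ, TestST (Ioo 0 T) ψ →
    (∫ t in Ioo (0:ℝ) T, ∫ x : V3, ∑ i,
      (u t x i * ptd (fun q => ψ q i) (t, x)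
        + u t x i * lapxd (fun q => ψ q i) (t, x)
        + u t x i * (∑ j, u t x j * pxd j (fun q => ψ q i) (t, x)))) = 0
/-- Schwartz class vector field. -/
def IsSchwartz (f : VF) : Prop :=
  ContDiff ℝ (⊤ : ℕ∞) f ∧ ∀ k n : ℕ, ∃ C, ∀ x : V3, ‖x‖ ^ k * ‖iteratedFDeriv ℝ n f x‖ ≤ C

/-- The classical operator `Lf = Δf + (x/2)·∇f + f/2`. -/
def Lcl (f : VF) (x : V3) : Fin 3 → ℝ :=
  fun i => lapv f i x + (∑ j, x j / 2 * pdv j f i x) + f x i / 2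



lemma lintegral_pow_le_aux {α : Type*} [MeasurableSpace α] (ν : Measure α) {r : ℝ} (hr : 1 ≤ r)
    (h : α → ENNReal) (hh : AEMeasurable h ν) :
    (∫⁻ s, h s ∂ν) ^ r ≤ (∫⁻ s, h s ^ r ∂ν) * ν univ ^ (r - 1) := by
  have hr0 : 0 < r := by linarith
  rcases eq_or_lt_of_le hr with rfl | hr1
  · simp
  have hpq := Real.HolderConjugate.conjExponent hr1
  have := ENNReal.lintegral_mul_le_Lp_mul_Lq ν hpq hh
    (aemeasurable_const (b := (1 : ENNReal)))
  simp only [Pi.mul_apply, mul_one, ENNReal.one_rpow, lintegral_const, one_mul] at this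
  calc (∫⁻ s, h s ∂ν) ^ r ≤ ((∫⁻ s, h s ^ r ∂ν) ^ (1 / r) * ν univ ^ (1 / r.conjExponent)) ^ r := by
        gcongr
    _ = _ := by
        rw [ENNReal.mul_rpow_of_nonneg _ _ hr0.le, ← ENNReal.rpow_mul, ← ENNReal.rpow_mul]
        congr 2
        · simp [hr0.ne']
        · rw [Real.conjExponent]; field_simp

lemma eLpNorm_integral_le {α : Type*} [MeasurableSpace α] (ν : Measure α) [IsFiniteMeasure ν]
    {p : ENNReal} (hp1 : 1 ≤ p) (hp : p ≠ ⊤) (F : α → V3 → ℝ)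
    (hF : AEStronglyMeasurable (fun q : α × V3 => F q.1 q.2) (ν.prod volume))
    (C : ENNReal) (hC : ∀ᵐ s ∂ν, eLpNorm (F s) p volume ≤ C) :
    eLpNorm (fun x => ∫ s, F s x ∂ν) p volume ≤ ν univ * C := by
  have hp0 : p ≠ 0 := (lt_of_lt_of_le zero_lt_one hp1).ne'
  have hr : 1 ≤ p.toReal := by
    rw [← ENNReal.toReal_one]; exact (ENNReal.toReal_le_toReal (by simp) hp).2 hp1
  set r := p.toReal with hrdef
  have hr0 : 0 < r := by linarith
  rw [eLpNorm_eq_lintegral_rpow_enorm_toReal hp0 hp]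
  rw [← hrdef, one_div, ENNReal.rpow_inv_le_iff hr0]
  have hFm : AEMeasurable (fun q : α × V3 => ‖F q.1 q.2‖ₑ ^ r) (ν.prod volume) :=
    hF.enorm.pow_const r
  calc ∫⁻ x, ‖∫ s, F s x ∂ν‖ₑ ^ r
      ≤ ∫⁻ x, (∫⁻ s, ‖F s x‖ₑ ∂ν) ^ r := by
        gcongr; exact enorm_integral_le_lintegral_enorm _
    _ ≤ ∫⁻ x, (∫⁻ s, ‖F s x‖ₑ ^ r ∂ν) * ν univ ^ (r - 1) := by
        have : ∀ᵐ x : V3, AEMeasurable (fun s => ‖F s x‖ₑ) ν := by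
          have h1 := hF.prod_swap
          filter_upwards [h1.prodMk_left] with x hx
          exact hx.enorm
        refine lintegral_mono_ae ?_
        filter_upwards [this] with x hx
        exact lintegral_pow_le_aux ν hr _ hx
    _ = (∫⁻ x, ∫⁻ s, ‖F s x‖ₑ ^ r ∂ν) * ν univ ^ (r - 1) := by
        rw [lintegral_mul_const']
        exact ENNReal.rpow_ne_top_of_nonneg (by linarith) (measure_ne_top _ _)
    _ = (∫⁻ s, (∫⁻ x, ‖F s x‖ₑ ^ r) ∂ν) * ν univ ^ (r - 1) := by
        rw [lintegral_lintegral_swap (f := fun s x => ‖F s x‖ₑ ^ r) hFm]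
    _ ≤ (∫⁻ s, C ^ r ∂ν) * ν univ ^ (r - 1) := by
        gcongr ?_ * _
        refine lintegral_mono_ae ?_
        filter_upwards [hC] with s hs
        rw [eLpNorm_eq_lintegral_rpow_enorm_toReal hp0 hp, one_div,
          ENNReal.rpow_inv_le_iff hr0] at hs
        exact hs
    _ = (ν univ * C) ^ r := by
        rw [lintegral_const, ENNReal.mul_rpow_of_nonneg _ _ hr0.le, mul_comm (C ^ r),
          mul_right_comm]
        congr 1
        by_cases h0 : ν univ = 0
        · simp [h0, hr0]
        nth_rewrite 1 [← ENNReal.rpow_one (ν univ)]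
        rw [← ENNReal.rpow_add _ _ h0 (measure_ne_top _ _)]
        congr 1; ring

/-- dominated convergence for bounded multipliers -/
lemma tendsto_mul_dom {p : ENNReal} (hp1 : 1 ≤ p) (hp : p ≠ ⊤) (a : ℕ → V3 → ℝ) (C : ℝ)
    (ham : ∀ n, Continuous (a n)) (haC : ∀ n x, |a n x| ≤ C)
    (ha0 : ∀ x, Tendsto (fun n => a n x) atTop (𝓝 0))
    (h : V3 → ℝ) (hh : MemLp h p volume) :
    Tendsto (fun n => eLpNorm (fun x => a n x * h x) p volume) atTop (𝓝 0) := by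
  have hp0 : p ≠ 0 := (lt_of_lt_of_le zero_lt_one hp1).ne'
  have hr0 : 0 < p.toReal := ENNReal.toReal_pos hp0 hp
  simp_rw [eLpNorm_eq_lintegral_rpow_enorm_toReal hp0 hp]
  have key : Tendsto (fun n => ∫⁻ x, ‖a n x * h x‖ₑ ^ p.toReal) atTop (𝓝 (∫⁻ x : V3, 0)) := by
    refine tendsto_lintegral_of_dominated_convergence' (fun x => ‖C * h x‖ₑ ^ p.toReal)
      ?_ ?_ ?_ ?_
    · intro n
      exact (((ham n).aestronglyMeasurable.mul hh.1).enorm).pow_const _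
    · intro n
      refine ae_of_all _ fun x => ?_
      dsimp only
      gcongr
      have hC : 0 ≤ C := (abs_nonneg _).trans (haC n x)
      rw [enorm_le_iff_norm_le, norm_mul, norm_mul]
      gcongr
      rw [Real.norm_eq_abs, Real.norm_eq_abs, abs_of_nonneg hC]; exact haC n x
    · have := (hh.const_mul C)
      exact (lintegral_rpow_enorm_lt_top_of_eLpNorm_lt_top hp0 hp this.2).ne
    · refine ae_of_all _ fun x => ?_
      have h1 : Tendsto (fun n => a n x * h x) atTop (𝓝 0) := by
        simpa using (ha0 x).mul_const (h x)
      have h2 := (continuous_enorm.tendsto _).comp h1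
      have h3 := (ENNReal.continuous_rpow_const (y := p.toReal)).tendsto _ |>.comp h2
      simpa [Function.comp_def, hr0] using h3
  rw [lintegral_zero] at key
  have h4 := (ENNReal.continuous_rpow_const (y := 1 / p.toReal)).tendsto _ |>.comp key
  simpa [Function.comp_def, hr0] using h4

/-- continuity of translations -/
lemma translate_small {p : ENNReal} (hp1 : 1 ≤ p) (hp : p ≠ ⊤) (u : V3 → ℝ)
    (hu : MemLp u p volume) {δ : ENNReal} (hδ : 0 < δ) :
    ∃ r > 0, ∀ h : V3, ‖h‖ < r → eLpNorm (fun x => u (x - h) - u x) p volume ≤ δ := by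
  have : Fact (1 ≤ p) := ⟨hp1⟩
  have : Fact (p ≠ ⊤) := ⟨hp⟩
  have hc : Continuous (fun c : V3 => (DomAddAct.mk c) +ᵥ hu.toLp u) :=
    (DomAddAct.continuous_mk).vadd continuous_const
  have ht := hc.tendsto 0
  rw [EMetric.tendsto_nhds] at ht
  have h1 := ht δ hδ
  rw [Metric.eventually_nhds_iff] at h1
  obtain ⟨r, hr, h2⟩ := h1
  refine ⟨r, hr, fun h hh => ?_⟩
  have h3 := h2 (y := -h) (by simpa using hh)
  rw [DomAddAct.mk_vadd_toLp, DomAddAct.mk_vadd_toLp, Lp.edist_toLp_toLp] at h3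
  refine le_trans (le_of_eq ?_) h3.le
  congr 1
  ext x
  simp [sub_eq_neg_add]


/-- convolution -/
def cv (u k : V3 → ℝ) (x : V3) : ℝ := ∫ y, u y * k (x - y)

lemma cv_eq_shift (u k : V3 → ℝ) (x : V3) : cv u k x = ∫ z, u (x - z) * k z := by
  rw [cv, ← integral_sub_left_eq_self _ volume x]
  simp

lemma aesm_shift (ν : Measure V3) [SFinite ν] (u : V3 → ℝ) (hu : AEStronglyMeasurable u volume)
    (e : ℝ) :
    AEStronglyMeasurable (fun q : V3 × V3 => u (q.2 - e • q.1)) (ν.prod volume) := by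
  have h1 : MeasurePreserving (fun q : V3 × V3 => (q.1, q.2 - e • q.1))
      (ν.prod volume) (ν.prod volume) := by
    refine (MeasurePreserving.id ν).skew_product (g := fun z x => x - e • z) ?_ ?_
    · fun_prop
    · refine ae_of_all _ fun z => ?_
      exact (measurePreserving_sub_right volume (e • z)).map_eq
  have h2 : Measure.QuasiMeasurePreserving (fun q : V3 × V3 => q.2 - e • q.1)
      (ν.prod volume) volume :=
    Measure.quasiMeasurePreserving_snd.comp h1.quasiMeasurePreserving
  exact hu.comp_quasiMeasurePreserving h2

lemma setInt_tsupport (k f : V3 → ℝ) : ∫ z, f z * k z = ∫ z in tsupport k, f z * k z := by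
  rw [setIntegral_eq_integral_of_forall_compl_eq_zero]
  intro z hz
  rw [image_eq_zero_of_notMem_tsupport hz, mul_zero]

lemma cs_bound (k : V3 → ℝ) (hk : Continuous k) (hs : HasCompactSupport k) :
    ∃ C, ∀ x, |k x| ≤ C := by
  obtain ⟨C, hC⟩ := hk.bounded_above_of_compact_support hs
  exact ⟨C, hC⟩

lemma eLpNorm_mul_const_le' (p : ENNReal) (f : V3 → ℝ) (c C : ℝ) (hC : |c| ≤ C) :
    eLpNorm (fun x => f x * c) p volume ≤ ‖C‖ₑ * eLpNorm f p volume := by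
  have h1 : (fun x => f x * c) = c • f := by
    ext x; simp [mul_comm]
  have hC0 : 0 ≤ C := (abs_nonneg _).trans hC
  rw [h1, eLpNorm_const_smul]
  gcongr
  rw [enorm_le_iff_norm_le, Real.norm_eq_abs, Real.norm_eq_abs, abs_of_nonneg hC0]; exact hC

lemma cv_eLpNorm_lt {p : ENNReal} (hp1 : 1 ≤ p) (hp : p ≠ ⊤) (u k : V3 → ℝ)
    (hu : MemLp u p volume) (hk : Continuous k) (hs : HasCompactSupport k) :
    eLpNorm (cv u k) p volume < ⊤ := by
  obtain ⟨C, hC⟩ := cs_bound k hk hs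
  have hfin : IsFiniteMeasure (volume.restrict (tsupport k)) :=
    ⟨by simpa using hs.isCompact.measure_lt_top⟩
  have he : cv u k = fun x => ∫ z in tsupport k, u (x - z) * k z := by
    ext x
    rw [cv_eq_shift, setInt_tsupport k (fun z => u (x - z))]
  rw [he]
  refine lt_of_le_of_lt (eLpNorm_integral_le (volume.restrict (tsupport k)) hp1 hp
    (fun z x => u (x - z) * k z) ?_ (‖C‖ₑ * eLpNorm u p volume) ?_) ?_
  · have := aesm_shift (volume.restrict (tsupport k)) u hu.1 1
    simp only [one_smul] at this
    exact this.mul (by fun_prop)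
  · refine ae_of_all _ fun z => ?_
    refine (eLpNorm_mul_const_le' p (fun x => u (x - z)) (k z) C (hC z)).trans ?_
    gcongr
    exact le_of_eq (eLpNorm_comp_measurePreserving hu.1 (measurePreserving_sub_right volume z))
  · exact ENNReal.mul_lt_top (measure_lt_top _ _) (ENNReal.mul_lt_top (by simp) hu.2)

/-- scaled kernel -/
def sc (e : ℝ) (k : V3 → ℝ) (z : V3) : ℝ := e⁻¹ ^ 3 * k (e⁻¹ • z)

lemma cv_sc (e : ℝ) (he : 0 < e) (u k : V3 → ℝ) (x : V3) :
    cv u (sc e k) x = ∫ z, u (x - e • z) * k z := by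
  rw [cv_eq_shift]
  have h := Measure.integral_comp_smul (volume : Measure V3)
    (fun z => u (x - e • z) * k z) e⁻¹
  simp only [smul_inv_smul₀ he.ne', Module.finrank_fin_fun] at h
  have h2 : ∀ z, u (x - z) * sc e k z = e⁻¹ ^ 3 * (u (x - z) * k (e⁻¹ • z)) := by
    intro z; simp only [sc]; ring
  simp_rw [h2]
  rw [integral_const_mul, h, smul_eq_mul, ← mul_assoc, abs_of_pos (by positivity),
    mul_inv_cancel₀ (by positivity), one_mul]

lemma locInt {p : ENNReal} (hp1 : 1 ≤ p) (u : V3 → ℝ) (hu : MemLp u p volume) :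
    LocallyIntegrable u volume := hu.locallyIntegrable hp1

lemma cv_small {p : ENNReal} (hp1 : 1 ≤ p) (hp : p ≠ ⊤) (u k : V3 → ℝ)
    (hu : MemLp u p volume) (hk : Continuous k) (hs : HasCompactSupport k) {δ : ENNReal}
    (hδ : 0 < δ) :
    ∃ r > 0, ∀ e : ℝ, 0 < e → e < r →
      eLpNorm (fun x => cv u (sc e k) x - (∫ z, k z) * u x) p volume ≤ δ := by
  obtain ⟨C, hC⟩ := cs_bound k hk hs
  have hC0 : 0 ≤ C := (abs_nonneg _).trans (hC 0)
  have hfin : IsFiniteMeasure (volume.restrict (tsupport k)) :=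
    ⟨by simpa using hs.isCompact.measure_lt_top⟩
  set m := (volume.restrict (tsupport k)) univ with hm
  have hmt : m ≠ ⊤ := measure_ne_top _ _
  obtain ⟨δ', hδ', hδ2⟩ : ∃ δ' : ENNReal, 0 < δ' ∧ m * (‖C‖ₑ * δ') ≤ δ := by
    refine ⟨δ / (m * ‖C‖ₑ), ENNReal.div_pos hδ.ne' (ENNReal.mul_ne_top hmt (by simp)), ?_⟩
    rw [← mul_assoc]; exact ENNReal.mul_div_le
  obtain ⟨r, hr, hr2⟩ := translate_small hp1 hp u hu hδ'
  obtain ⟨B, hB⟩ := hs.isCompact.isBounded.exists_norm_le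
  refine ⟨r / (|B| + 1), by positivity, fun e he0 her => ?_⟩
  have heq : (fun x => cv u (sc e k) x - (∫ z, k z) * u x)
      = fun x => ∫ z in tsupport k, (u (x - e • z) - u x) * k z := by
    ext x
    rw [cv_sc e he0, ← setInt_tsupport k (fun z => (u (x - e • z) - u x))]
    have hi1 : Integrable (fun z => u (x - e • z) * k z) := by
      have hl : LocallyIntegrable (fun z => u (x - e • z)) volume := by
        have h1 : MemLp (fun z => u (x - z)) p volume :=
          hu.comp_measurePreserving (Measure.measurePreserving_sub_left volume x)
        have h2 : LocallyIntegrable (fun z => u (x - z)) volume := h1.locallyIntegrable hp1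
        intro y
        obtain ⟨s, hsn, hsi⟩ := h2 (e • y)
        refine ⟨(e • ·) ⁻¹' s, (continuous_const_smul e).continuousAt hsn, ?_⟩
        have := (Homeomorph.smulOfNeZero e he0.ne' : V3 ≃ₜ V3).toMeasurableEquiv
        rw [IntegrableOn]
        have hmap := Measure.map_addHaar_smul (volume : Measure V3) he0.ne'
        have hemb : MeasurableEmbedding (fun z : V3 => e • z) :=
          (Homeomorph.smulOfNeZero e he0.ne' : V3 ≃ₜ V3).measurableEmbedding
        have h4 := hemb.integrableOn_map_iff (f := fun z => u (x - z)) (μ := volume) (s := s)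
        rw [hmap] at h4
        refine h4.1 ?_
        rw [IntegrableOn, Measure.restrict_smul]
        exact Integrable.smul_measure hsi (by simp)
      have := hl.integrable_smul_left_of_hasCompactSupport hk hs
      simpa [mul_comm] using this
    have hi2 : Integrable (fun z => u x * k z) :=
      (hk.integrable_of_hasCompactSupport hs).const_mul _
    simp_rw [sub_mul]
    rw [integral_sub hi1 hi2, integral_const_mul, mul_comm (u x)]
  rw [heq]
  refine le_trans (eLpNorm_integral_le (volume.restrict (tsupport k)) hp1 hp
    (fun z x => (u (x - e • z) - u x) * k z) ?_ (‖C‖ₑ * δ') ?_) hδ2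
  · refine ((aesm_shift _ u hu.1 e).sub ?_).mul (by fun_prop)
    exact hu.1.comp_quasiMeasurePreserving Measure.quasiMeasurePreserving_snd
  · refine (ae_restrict_iff' (isClosed_tsupport k).measurableSet).2 (ae_of_all _ fun z hz => ?_)
    refine (eLpNorm_mul_const_le' p (fun x => u (x - e • z) - u x) (k z) C (hC z)).trans ?_
    gcongr
    · apply hr2
      rw [norm_smul, Real.norm_eq_abs, abs_of_pos he0]
      have hzB : ‖z‖ ≤ |B| := (hB z hz).trans (le_abs_self B)
      rw [lt_div_iff₀ (by positivity)] at her
      nlinarith [norm_nonneg z]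

lemma pd_smooth (j : Fin 3) {f : V3 → ℝ} (hf : ContDiff ℝ (⊤ : ℕ∞) f) :
    ContDiff ℝ (⊤ : ℕ∞) (pd j f) := by
  unfold pd
  exact (hf.fderiv_right (m := (⊤ : ℕ∞)) (by simp)).clm_apply contDiff_const

lemma pd_test (j : Fin 3) {f : V3 → ℝ} (hf : TestS f) : TestS (pd j f) := by
  refine ⟨pd_smooth j hf.1, ?_⟩
  unfold pd
  exact hf.2.fderiv_apply (𝕜 := ℝ) _

lemma cv_smooth (u k : V3 → ℝ) (hu : LocallyIntegrable u volume) (hk : TestS k) :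
    ContDiff ℝ (⊤ : ℕ∞) (cv u k) :=
  hk.2.contDiff_convolution_right (ContinuousLinearMap.mul ℝ ℝ) hu hk.1

lemma pd_cv (j : Fin 3) (u k : V3 → ℝ) (hu : LocallyIntegrable u volume) (hk : TestS k) :
    pd j (cv u k) = cv u (pd j k) := by
  ext x
  have h := (hk.2.hasFDerivAt_convolution_right (ContinuousLinearMap.mul ℝ ℝ) hu
    (hk.1.of_le (by exact_mod_cast le_top)) x).fderiv
  have h2 : cv u k = MeasureTheory.convolution u k (ContinuousLinearMap.mul ℝ ℝ) volume := rfl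
  rw [pd, h2, h, convolution_precompR_apply _ hu (hk.2.fderiv (𝕜 := ℝ))
    (hk.1.continuous_fderiv (by simp))]
  rfl

lemma cv_integrable (u k : V3 → ℝ) (hu : LocallyIntegrable u volume) (hk : TestS k) (x : V3) :
    Integrable (fun y => u y * k (x - y)) :=
  hk.2.convolutionExists_right (ContinuousLinearMap.mul ℝ ℝ) hu hk.1.continuous x

lemma cv_memLp {p : ENNReal} (hp1 : 1 ≤ p) (hp : p ≠ ⊤) (u k : V3 → ℝ)
    (hu : MemLp u p volume) (hk : TestS k) : MemLp (cv u k) p volume :=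
  ⟨(cv_smooth u k (hu.locallyIntegrable hp1) hk).continuous.aestronglyMeasurable,
    cv_eLpNorm_lt hp1 hp u k hu hk.1.continuous hk.2⟩


abbrev Sm (f : V3 → ℝ) : Prop := ContDiff ℝ (⊤ : ℕ∞) f

lemma Sm.diff {f : V3 → ℝ} (hf : Sm f) : Differentiable ℝ f := hf.differentiable (by simp)

lemma pd_mul (j : Fin 3) {f g : V3 → ℝ} (hf : Sm f) (hg : Sm g) (x : V3) :
    pd j (fun y => f y * g y) x = pd j f x * g x + f x * pd j g x := by
  simp only [pd]
  rw [fderiv_fun_mul (hf.diff x) (hg.diff x)]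
  simp; ring

lemma pd_add (j : Fin 3) {f g : V3 → ℝ} (hf : Sm f) (hg : Sm g) (x : V3) :
    pd j (fun y => f y + g y) x = pd j f x + pd j g x := by
  simp only [pd]
  rw [fderiv_fun_add (hf.diff x) (hg.diff x)]
  simp

lemma pd_sub (j : Fin 3) {f g : V3 → ℝ} (hf : Sm f) (hg : Sm g) (x : V3) :
    pd j (fun y => f y - g y) x = pd j f x - pd j g x := by
  simp only [pd]
  rw [fderiv_fun_sub (hf.diff x) (hg.diff x)]
  simp

lemma pd_sum (j : Fin 3) {f : Fin 3 → V3 → ℝ} (hf : ∀ i, Sm (f i)) (x : V3) :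
    pd j (fun y => ∑ i, f i y) x = ∑ i, pd j (f i) x := by
  simp only [pd]
  rw [fderiv_fun_sum (fun i _ => (hf i).diff x)]
  simp

lemma pd_const_mul (j : Fin 3) (c : ℝ) {f : V3 → ℝ} (hf : Sm f) (x : V3) :
    pd j (fun y => c * f y) x = c * pd j f x := by
  simp only [pd]
  rw [fderiv_const_mul (hf.diff x)]
  simp

lemma sm_coord (i : Fin 3) : Sm (fun x : V3 => x i) := contDiff_apply ℝ ℝ i

lemma pd_coord (i j : Fin 3) (x : V3) : pd j (fun y : V3 => y i) x = if i = j then 1 else 0 := by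
  simp only [pd]
  have : (fun y : V3 => y i) = (ContinuousLinearMap.proj (R := ℝ) (φ := fun _ : Fin 3 => ℝ) i) := rfl
  rw [this, ContinuousLinearMap.fderiv]
  simp [Pi.single_apply]

lemma sm_smul (c : ℝ) {f : V3 → ℝ} (hf : Sm f) : Sm (fun x => f (c • x)) :=
  hf.comp (contDiff_const_smul c)

lemma pd_smul (j : Fin 3) (c : ℝ) (f : V3 → ℝ) (x : V3) :
    pd j (fun y => f (c • y)) x = c * pd j f (c • x) := by
  simp only [pd]
  rw [fderiv_comp_smul]
  simp

lemma pd_comm (i j : Fin 3) {f : V3 → ℝ} (hf : Sm f) (x : V3) :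
    pd i (pd j f) x = pd j (pd i f) x := by
  have h1 : ∀ a b : Fin 3, pd a (pd b f) x
      = fderiv ℝ (fderiv ℝ f) x (Pi.single a 1) (Pi.single b 1) := by
    intro a b
    have hd : DifferentiableAt ℝ (fderiv ℝ f) x :=
      (hf.fderiv_right (m := (⊤ : ℕ∞)) (by simp)).differentiable (by simp) x
    show fderiv ℝ (fun y => fderiv ℝ f y (Pi.single b 1)) x (Pi.single a 1) = _
    rw [fderiv_clm_apply hd (differentiableAt_const _)]
    simp
  rw [h1, h1]
  have := (hf.contDiffAt (x := x)).isSymmSndFDerivAt (by simp; exact WithTop.coe_le_coe.2 (le_top : (2 : ℕ∞) ≤ ⊤))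
  exact this _ _

lemma pd_refl (j : Fin 3) {f : V3 → ℝ} (hf : Sm f) (x y : V3) :
    pd j (fun y => f (x - y)) y = - pd j f (x - y) := by
  simp only [pd]
  have h1 : HasFDerivAt (fun y : V3 => x - y) (-(ContinuousLinearMap.id ℝ V3)) y :=
    (hasFDerivAt_id y).const_sub x
  have := ((hf.diff (x - y)).hasFDerivAt.comp y h1).fderiv
  simp only [Function.comp_def] at this
  rw [this]
  simp

lemma sm_refl {f : V3 → ℝ} (hf : Sm f) (x : V3) : Sm (fun y => f (x - y)) :=
  hf.comp (contDiff_const.sub contDiff_id)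

lemma test_refl {f : V3 → ℝ} (hf : TestS f) (x : V3) : TestS (fun y => f (x - y)) :=
  ⟨sm_refl hf.1 x, hf.2.comp_homeomorph (Homeomorph.subLeft x)⟩

lemma test_add {f g : V3 → ℝ} (hf : TestS f) (hg : TestS g) : TestS (fun y => f y + g y) :=
  ⟨hf.1.add hg.1, hf.2.add hg.2⟩
lemma test_mul {f g : V3 → ℝ} (hf : Sm f) (hg : TestS g) : TestS (fun y => f y * g y) :=
  ⟨hf.mul hg.1, hg.2.mul_left⟩
lemma test_cmul (c : ℝ) {g : V3 → ℝ} (hg : TestS g) : TestS (fun y => c * g y) :=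
  test_mul contDiff_const hg
lemma test_sum {f : Fin 3 → V3 → ℝ} (hf : ∀ i, TestS (f i)) : TestS (fun y => ∑ i, f i y) := by
  simp only [Fin.sum_univ_three]
  exact test_add (test_add (hf 0) (hf 1)) (hf 2)
lemma test_smul (c : ℝ) (hc : c ≠ 0) {f : V3 → ℝ} (hf : TestS f) : TestS (fun x => f (c • x)) :=
  ⟨sm_smul c hf.1, hf.2.comp_smul hc⟩

lemma cv_add (u : V3 → ℝ) (hu : LocallyIntegrable u volume) {a b : V3 → ℝ} (ha : TestS a)
    (hb : TestS b) (x : V3) : cv u (fun z => a z + b z) x = cv u a x + cv u b x := by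
  simp only [cv, mul_add]
  exact integral_add (cv_integrable u a hu ha x) (cv_integrable u b hu hb x)

lemma cv_cmul (u : V3 → ℝ) (c : ℝ) (a : V3 → ℝ) (x : V3) :
    cv u (fun z => c * a z) x = c * cv u a x := by
  simp only [cv]
  rw [← integral_const_mul]
  congr 1; ext y; ring

lemma cv_sum (u : V3 → ℝ) (hu : LocallyIntegrable u volume) {a : Fin 3 → V3 → ℝ}
    (ha : ∀ i, TestS (a i)) (x : V3) : cv u (fun z => ∑ i, a i z) x = ∑ i, cv u (a i) x := by
  simp only [Fin.sum_univ_three]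
  rw [cv_add u hu (test_add (ha 0) (ha 1)) (ha 2), cv_add u hu (ha 0) (ha 1)]

/-- commutator kernel -/
def kp (k : V3 → ℝ) (z : V3) : ℝ := (∑ j, z j / 2 * pd j k z) + 3 / 2 * k z

lemma sm_coordh (j : Fin 3) : Sm (fun x : V3 => x j / 2) := (sm_coord j).div_const 2

lemma kp_test {k : V3 → ℝ} (hk : TestS k) : TestS (kp k) :=
  test_add (test_sum fun j => test_mul (sm_coordh j) (pd_test j hk)) (test_cmul _ hk)

lemma kp_sc (e : ℝ) {k : V3 → ℝ} (hk : TestS k) : kp (sc e k) = sc e (kp k) := by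
  ext z
  have h : ∀ j, pd j (sc e k) z = e⁻¹ ^ 3 * (e⁻¹ * pd j k (e⁻¹ • z)) := by
    intro j
    have h1 : sc e k = fun y => e⁻¹ ^ 3 * (fun w => k (e⁻¹ • w)) y := rfl
    rw [h1, pd_const_mul j _ (sm_smul _ hk.1), pd_smul]
  simp only [kp, h, sc, Pi.smul_apply, smul_eq_mul, Fin.sum_univ_three]
  ring

lemma test_int {k : V3 → ℝ} (hk : TestS k) : Integrable k :=
  hk.1.continuous.integrable_of_hasCompactSupport hk.2

lemma kp_integral {k : V3 → ℝ} (hk : TestS k) : ∫ z, kp k z = 0 := by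
  have h : ∀ j, ∫ z : V3, z j * pd j k z = - ∫ z, k z := by
    intro j
    have := integral_mul_fderiv_eq_neg_fderiv_mul_of_integrable (μ := (volume : Measure V3))
      (f := fun z : V3 => z j) (g := k) (v := Pi.single j 1) ?_ ?_ ?_
      (fun x _ => (sm_coord j).diff x) (fun x _ => Sm.diff hk.1 x)
    · have h2 : ∀ x, fderiv ℝ (fun z : V3 => z j) x (Pi.single j 1) = 1 := by
        intro x
        have := pd_coord j j x
        simpa [pd] using this
      simp only [h2, one_mul] at this
      exact this
    · have h2 : ∀ x, fderiv ℝ (fun z : V3 => z j) x (Pi.single j 1) = 1 := by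
        intro x
        have := pd_coord j j x
        simpa [pd] using this
      simp only [h2, one_mul]
      exact test_int hk
    · exact test_int (test_mul (sm_coord j) (pd_test j hk))
    · exact test_int (test_mul (sm_coord j) hk)
  have hI : ∀ j, Integrable (fun z : V3 => z j * pd j k z) := fun j =>
    test_int (test_mul (sm_coord j) (pd_test j hk))
  have he : kp k = (((fun z => 1 / 2 * (z 0 * pd 0 k z)) + (fun z => 1 / 2 * (z 1 * pd 1 k z)))
      + (fun z => 1 / 2 * (z 2 * pd 2 k z))) + (fun z => 3 / 2 * k z) := by
    ext z; simp only [kp, Fin.sum_univ_three, Pi.add_apply]; ring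
  have i0 := (hI 0).const_mul (1 / 2)
  have i1 := (hI 1).const_mul (1 / 2)
  have i2 := (hI 2).const_mul (1 / 2)
  rw [he, integral_add' ((i0.add i1).add i2) ((test_int hk).const_mul _),
    integral_add' (i0.add i1) i2, integral_add' i0 i1]
  simp only [integral_const_mul, h]
  ring

lemma sc_test (e : ℝ) (he : 0 < e) {k : V3 → ℝ} (hk : TestS k) : TestS (sc e k) :=
  test_cmul _ (test_smul _ (inv_ne_zero he.ne') hk)

lemma exists_rho : ∃ ρ : V3 → ℝ, TestS ρ ∧ ∫ z, ρ z = 1 := by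
  let b : ContDiffBump (0 : V3) := ⟨1, 2, by norm_num, by norm_num⟩
  exact ⟨b.normed volume, ⟨b.contDiff_normed, b.hasCompactSupport_normed⟩, b.integral_normed⟩

lemma comp_memLp {p : ENNReal} {u : VF} (hu : MemLp u p volume) (i : Fin 3) :
    MemLp (fun x => u x i) p volume := by
  refine hu.of_le ?_ (ae_of_all _ fun x => norm_le_pi_norm (u x) i)
  exact (continuous_apply i).comp_aestronglyMeasurable hu.1

lemma cv_ev {p : ENNReal} (hp1 : 1 ≤ p) (hp : p ≠ ⊤) (u k : V3 → ℝ)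
    (hu : MemLp u p volume) (hk : TestS k) {δ : ENNReal} (hδ : 0 < δ) :
    ∀ᶠ e in 𝓝[>] (0 : ℝ),
      eLpNorm (fun x => cv u (sc e k) x - (∫ z, k z) * u x) p volume ≤ δ := by
  obtain ⟨r, hr, h⟩ := cv_small hp1 hp u k hu hk.1.continuous hk.2 hδ
  filter_upwards [Ioo_mem_nhdsGT hr] with e he using h e he.1 he.2

lemma Lcl_cv (φ g : VF) (i : Fin 3) (hu : LocallyIntegrable (fun x => φ x i) volume)
    (hLg : IsLof φ g) {K : V3 → ℝ} (hK : TestS K) (x : V3) :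
    Lcl (fun x i => cv (fun y => φ y i) K x) x i
      = cv (fun y => g y i) K x + cv (fun y => φ y i) (kp K) x := by
  set u := fun y => φ y i with hudef
  have h1 := hLg i (fun y => K (x - y)) (test_refl hK x)
  have hA : TestS (fun z => (∑ j, pd j (pd j K) z) + ((∑ j, (x j - z j) / 2 * pd j K z)
      + (-1) * K z)) :=
    test_add (test_sum fun j => pd_test j (pd_test j hK))
      (test_add (test_sum fun j => test_mul ((contDiff_const.sub (sm_coord j)).div_const 2)
        (pd_test j hK)) (test_cmul _ hK))
  have h2 : cv (fun y => g y i) K x = cv u (fun z => (∑ j, pd j (pd j K) z)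
      + ((∑ j, (x j - z j) / 2 * pd j K z) + (-1) * K z)) x := by
    rw [cv, h1, cv]
    congr 1; ext y
    have e1 : ∀ j, pd j (fun y => K (x - y)) = fun y => - pd j K (x - y) := by
      intro j; ext y; exact pd_refl j hK.1 x y
    have e2 : ∀ j, pd j (fun y => - pd j K (x - y)) y = pd j (pd j K) (x - y) := by
      intro j
      have : (fun y => - pd j K (x - y)) = fun y => (-1) * (fun w => pd j K (x - w)) y := by
        ext y; simp
      rw [this, pd_const_mul j _ (sm_refl (pd_smooth j hK.1) x), pd_refl j (pd_smooth j hK.1)]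
      ring
    simp only [lap, e1, e2, Fin.sum_univ_three, Pi.sub_apply, hudef]
    ring
  have h3 : Lcl (fun x i => cv (fun y => φ y i) K x) x i
      = cv u (fun z => (∑ j, pd j (pd j K) z) + ((∑ j, x j / 2 * pd j K z) + 1 / 2 * K z)) x := by
    rw [cv_add u hu (test_sum fun j => pd_test j (pd_test j hK))
      (test_add (test_sum fun j => test_cmul _ (pd_test j hK)) (test_cmul _ hK)),
      cv_add u hu (test_sum fun j => test_cmul _ (pd_test j hK)) (test_cmul _ hK),
      cv_sum u hu (fun j => pd_test j (pd_test j hK)),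
      cv_sum u hu (fun j => test_cmul _ (pd_test j hK))]
    simp only [cv_cmul, Lcl, lapv, lap, pdv]
    have e1 : ∀ j, pd j (fun y => cv (fun y => φ y i) K y) = cv (fun y => φ y i) (pd j K) :=
      fun j => pd_cv j u K hu hK
    have e2 : ∀ j, pd j (fun y => cv (fun y => φ y i) (pd j K) y) x
        = cv (fun y => φ y i) (pd j (pd j K)) x :=
      fun j => congrFun (pd_cv j u (pd j K) hu (pd_test j hK)) x
    simp only [e1, e2, hudef]
    ring
  rw [h3, h2, ← cv_add u hu hA (kp_test hK)]
  congr 1; ext z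
  simp only [kp, Fin.sum_univ_three]; ring

lemma mollify (φ g : VF) (hφ : InX φ) (hg : MemL24 g) (hLg : IsLof φ g) {δ : ENNReal}
    (hδ : 0 < δ) :
    ∃ f : VF, (∀ i, Sm (fun x => f x i)) ∧ DivFreePt f ∧
      ∀ p : ENNReal, (p = 2 ∨ p = 4) → ∀ i,
        MemLp (fun x => f x i) p volume ∧ (∀ j, MemLp (pd j (fun x => f x i)) p volume) ∧
        MemLp (lap (fun x => f x i)) p volume ∧ MemLp (fun x => Lcl f x i) p volume ∧
        eLpNorm (fun x => f x i - φ x i) p volume ≤ δ ∧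
        eLpNorm (fun x => Lcl f x i - g x i) p volume ≤ δ := by
  obtain ⟨ρ, hρ, hρ1⟩ := exists_rho
  have hφp : ∀ p : ENNReal, (p = 2 ∨ p = 4) → ∀ i, MemLp (fun x => φ x i) p volume := by
    rintro p (rfl | rfl) i
    · exact comp_memLp hφ.1.1 i
    · exact comp_memLp hφ.1.2 i
  have hgp : ∀ p : ENNReal, (p = 2 ∨ p = 4) → ∀ i, MemLp (fun x => g x i) p volume := by
    rintro p (rfl | rfl) i
    · exact comp_memLp hg.1 i
    · exact comp_memLp hg.2 i
  have hp1 : ∀ p : ENNReal, (p = 2 ∨ p = 4) → 1 ≤ p := by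
    rintro p (rfl | rfl) <;> norm_num
  have hpt : ∀ p : ENNReal, (p = 2 ∨ p = 4) → p ≠ ⊤ := by
    rintro p (rfl | rfl) <;> simp
  have hu : ∀ i, LocallyIntegrable (fun x => φ x i) volume := fun i =>
    (hφp 2 (Or.inl rfl) i).locallyIntegrable (hp1 2 (Or.inl rfl))
  have hδ2 : 0 < δ / 2 := ENNReal.div_pos hδ.ne' (by simp)
  have ev : ∀ p : ENNReal, (p = 2 ∨ p = 4) → ∀ᶠ e in 𝓝[>] (0 : ℝ), ∀ i,
      eLpNorm (fun x => cv (fun y => φ y i) (sc e ρ) x - (∫ z, ρ z) * φ x i) p volume ≤ δ ∧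
      eLpNorm (fun x => cv (fun y => g y i) (sc e ρ) x - (∫ z, ρ z) * g x i) p volume ≤ δ / 2 ∧
      eLpNorm (fun x => cv (fun y => φ y i) (sc e (kp ρ)) x - (∫ z, kp ρ z) * φ x i) p volume
        ≤ δ / 2 := by
    intro p hp
    rw [eventually_all]
    intro i
    filter_upwards [cv_ev (hp1 p hp) (hpt p hp) _ ρ (hφp p hp i) hρ hδ,
      cv_ev (hp1 p hp) (hpt p hp) _ ρ (hgp p hp i) hρ hδ2,
      cv_ev (hp1 p hp) (hpt p hp) _ _ (hφp p hp i) (kp_test hρ) hδ2] with e h1 h2 h3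
      using ⟨h1, h2, h3⟩
  have epos : ∀ᶠ e in 𝓝[>] (0 : ℝ), 0 < e := eventually_mem_nhdsWithin
  obtain ⟨e, he, h2, h4⟩ := (epos.and ((ev 2 (Or.inl rfl)).and (ev 4 (Or.inr rfl)))).exists
  have hK := sc_test e he hρ
  refine ⟨fun x i => cv (fun y => φ y i) (sc e ρ) x, fun i => cv_smooth _ _ (hu i) hK, ?_, ?_⟩
  · intro x
    have h := hφ.2 (fun y => sc e ρ (x - y)) (test_refl hK x)
    simp only [pdv]
    have e1 : ∀ i, pd i (fun y => cv (fun y => φ y i) (sc e ρ) y) x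
      = cv (fun y => φ y i) (pd i (sc e ρ)) x := fun i => congrFun (pd_cv i _ _ (hu i) hK) x
    simp only [e1]
    have e2 : ∀ i, Integrable (fun y => φ y i * pd i (fun y => sc e ρ (x - y)) y) := by
      intro i
      have := (cv_integrable _ _ (hu i) (pd_test i hK) x).neg
      refine this.congr (ae_of_all _ fun y => ?_)
      simp [pd_refl i hK.1 x y]
    rw [integral_finsetSum _ (fun i _ => e2 i)] at h
    rw [← neg_eq_zero, ← Finset.sum_neg_distrib, ← h]
    refine Finset.sum_congr rfl fun i _ => ?_
    rw [cv, ← integral_neg]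
    congr 1; ext y
    rw [pd_refl i hK.1 x y]; ring
  · intro p hp i
    have h : eLpNorm (fun x => cv (fun y => φ y i) (sc e ρ) x - (∫ z, ρ z) * φ x i) p volume ≤ δ ∧
      eLpNorm (fun x => cv (fun y => g y i) (sc e ρ) x - (∫ z, ρ z) * g x i) p volume ≤ δ / 2 ∧
      eLpNorm (fun x => cv (fun y => φ y i) (sc e (kp ρ)) x - (∫ z, kp ρ z) * φ x i) p volume
        ≤ δ / 2 := by
      rcases hp with rfl | rfl
      · exact h2 i
      · exact h4 i
    have hφi := hφp p hp i
    have hgi := hgp p hp i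
    have hL : (fun x => Lcl (fun x i => cv (fun y => φ y i) (sc e ρ) x) x i)
      = fun x => cv (fun y => g y i) (sc e ρ) x + cv (fun y => φ y i) (sc e (kp ρ)) x := by
      ext x
      rw [Lcl_cv φ g i (hu i) hLg hK, kp_sc e hρ]
    have hm1 := cv_memLp (hp1 p hp) (hpt p hp) _ _ hgi hK
    have hm2 := cv_memLp (hp1 p hp) (hpt p hp) _ _ hφi (sc_test e he (kp_test hρ))
    refine ⟨cv_memLp (hp1 p hp) (hpt p hp) _ _ hφi hK, fun j => ?_, ?_, ?_, ?_, ?_⟩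
    · rw [show (fun x => cv (fun y => φ y i) (sc e ρ) x) = cv (fun y => φ y i) (sc e ρ) from rfl,
        pd_cv j _ _ (hu i) hK]
      exact cv_memLp (hp1 p hp) (hpt p hp) _ _ hφi (pd_test j hK)
    · have e1 : ∀ j, pd j (fun y => cv (fun y => φ y i) (sc e ρ) y)
        = cv (fun y => φ y i) (pd j (sc e ρ)) := fun j => pd_cv j _ _ (hu i) hK
      have e2 : ∀ j x, pd j (fun y => cv (fun y => φ y i) (pd j (sc e ρ)) y) x
        = cv (fun y => φ y i) (pd j (pd j (sc e ρ))) x := fun j x =>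
          congrFun (pd_cv j _ _ (hu i) (pd_test j hK)) x
      have e3 : lap (fun x => cv (fun y => φ y i) (sc e ρ) x)
        = fun x => ∑ j, cv (fun y => φ y i) (pd j (pd j (sc e ρ))) x := by
        ext x
        simp only [lap, e1, e2]
      rw [e3]
      exact memLp_finsetSum _ fun j _ =>
        cv_memLp (hp1 p hp) (hpt p hp) _ _ hφi (pd_test j (pd_test j hK))
    · rw [hL]; exact hm1.add hm2
    · simpa [hρ1] using h.1
    · have e1 : (fun x => Lcl (fun x i => cv (fun y => φ y i) (sc e ρ) x) x i - g x i)
        = (fun x => cv (fun y => g y i) (sc e ρ) x - (∫ z, ρ z) * g x i)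
          + (fun x => cv (fun y => φ y i) (sc e (kp ρ)) x - (∫ z, kp ρ z) * φ x i) := by
        ext x
        have := congrFun hL x
        rw [this, hρ1, kp_integral hρ]
        simp; ring
      rw [e1]
      refine (eLpNorm_add_le ?_ ?_ (hp1 p hp)).trans ?_
      · exact hm1.1.sub (hgi.const_mul _).1
      · exact hm2.1.sub (hφi.const_mul _).1
      · calc _ ≤ δ / 2 + δ / 2 := add_le_add h.2.1 h.2.2
          _ = δ := ENNReal.add_halves δ


/-- Hardy type averaging operator -/
def Bo (m : ℕ) (h : V3 → ℝ) (x : V3) : ℝ := ∫ s in Ioc (0 : ℝ) 1, 2 * s ^ m * h (s ^ 2 • x)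

lemma eLpNorm_comp_smul' {p : ENNReal} (hp : p ≠ ⊤) (h : V3 → ℝ) (hh : Continuous h)
    {c : ℝ} (hc : 0 < c) :
    eLpNorm (fun x => h (c • x)) p volume
      = ENNReal.ofReal ((c ^ 3)⁻¹) ^ (1 / p.toReal) * eLpNorm h p volume := by
  have hmap := Measure.map_addHaar_smul (volume : Measure V3) hc.ne'
  rw [Module.finrank_fin_fun, abs_of_pos (by positivity)] at hmap
  have h1 : eLpNorm h p (Measure.map (fun x : V3 => c • x) volume)
      = eLpNorm (h ∘ fun x => c • x) p volume :=
    eLpNorm_map_measure hh.aestronglyMeasurable (by fun_prop)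
  rw [show (fun x => h (c • x)) = h ∘ fun x => c • x from rfl, ← h1, hmap,
    eLpNorm_smul_measure_of_ne_top hp]
  simp

lemma Bo_bound {p : ENNReal} (hp2 : 2 ≤ p) (hp : p ≠ ⊤) (h : V3 → ℝ) (hh : Continuous h)
    {m : ℕ} (hm : 3 ≤ m) {s : ℝ} (hs : s ∈ Ioc (0 : ℝ) 1) :
    eLpNorm (fun x => 2 * s ^ m * h (s ^ 2 • x)) p volume ≤ 2 * eLpNorm h p volume := by
  obtain ⟨hs0, hs1⟩ := hs
  have hr : 2 ≤ p.toReal := by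
    have := (ENNReal.toReal_le_toReal (by simp) hp).2 hp2
    simpa using this
  have h1 : (fun x => 2 * s ^ m * h (s ^ 2 • x)) = (2 * s ^ m) • (fun x => h (s ^ 2 • x)) := by
    ext x; simp
  rw [h1, eLpNorm_const_smul, eLpNorm_comp_smul' hp h hh (by positivity), ← mul_assoc]
  gcongr
  rw [Real.enorm_of_nonneg (by positivity), ENNReal.ofReal_rpow_of_nonneg (by positivity)
    (by positivity), ← ENNReal.ofReal_mul (by positivity)]
  rw [show (2 : ENNReal) = ENNReal.ofReal 2 by simp]
  apply ENNReal.ofReal_le_ofReal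
  have h2 : ((s ^ 2) ^ 3)⁻¹ ^ (1 / p.toReal) ≤ (s ^ 3)⁻¹ := by
    calc ((s ^ 2) ^ 3)⁻¹ ^ (1 / p.toReal) ≤ ((s ^ 2) ^ 3)⁻¹ ^ (1 / 2 : ℝ) := by
          apply Real.rpow_le_rpow_of_exponent_le
          · rw [one_le_inv₀ (by positivity)]
            exact pow_le_one₀ (by positivity) (pow_le_one₀ hs0.le hs1)
          · exact one_div_le_one_div_of_le (by norm_num) hr
      _ = (s ^ 3)⁻¹ := by
          rw [← Real.sqrt_eq_rpow, show ((s ^ 2) ^ 3)⁻¹ = ((s ^ 3)⁻¹) ^ 2 by field_simp,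
            Real.sqrt_sq (by positivity)]
  have h3 : s ^ m ≤ s ^ 3 := pow_le_pow_of_le_one hs0.le hs1 hm
  calc 2 * s ^ m * ((s ^ 2) ^ 3)⁻¹ ^ (1 / p.toReal) ≤ 2 * s ^ 3 * (s ^ 3)⁻¹ := by gcongr
    _ = 2 := by field_simp

lemma Bo_smooth (m : ℕ) (h : V3 → ℝ) (hh : Sm h) : Sm (Bo m h) := by
  let b : ContDiffBump (0 : ℝ) := ⟨1, 2, by norm_num, by norm_num⟩
  let f : ℝ → ℝ := indicator (Ioc (0 : ℝ) 1) (fun s => 2 * s ^ m)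
  let g : V3 → ℝ → ℝ := fun x s => b s * h (s ^ 2 • x)
  have hf : LocallyIntegrable f volume := by
    apply Integrable.locallyIntegrable
    rw [integrable_indicator_iff measurableSet_Ioc]
    exact (Continuous.integrableOn_Icc (by fun_prop)).mono_set Ioc_subset_Icc_self
  have hg : ContDiff ℝ (⊤ : ℕ∞) ↿g := by
    have h1 : ContDiff ℝ (⊤ : ℕ∞) (fun q : V3 × ℝ => q.2 ^ 2 • q.1) :=
      (contDiff_snd.pow 2).smul contDiff_fst
    exact (b.contDiff.comp contDiff_snd).mul (hh.comp h1)
  have key := contDiffOn_convolution_right_with_param_comp (μ := volume) (n := ⊤)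
    (ContinuousLinearMap.mul ℝ ℝ) (s := (univ : Set V3)) (v := fun _ => (0 : ℝ)) contDiffOn_const
    (f := f) (g := g) (k := tsupport b) isOpen_univ b.hasCompactSupport.isCompact ?_ hf hg.contDiffOn
  · rw [contDiffOn_univ] at key
    convert key using 1
    ext x
    rw [Bo, ← integral_indicator measurableSet_Ioc, convolution_def]
    congr 1; ext s
    by_cases hs : s ∈ Ioc (0 : ℝ) 1
    · have hb : b (-s) = 1 := by
        apply b.one_of_mem_closedBall
        simp [abs_of_pos hs.1, b, hs.2]
      simp [f, g, hs, hb]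
    · simp [f, g, hs]
  · intro x s _ hs
    simp [g, image_eq_zero_of_notMem_tsupport hs]

lemma Bo_memLp {p : ENNReal} (hp2 : 2 ≤ p) (hp : p ≠ ⊤) (h : V3 → ℝ) (hh : Sm h)
    (hL : MemLp h p volume) {m : ℕ} (hm : 3 ≤ m) : MemLp (Bo m h) p volume := by
  refine ⟨(Bo_smooth m h hh).continuous.aestronglyMeasurable, ?_⟩
  have hc := hh.continuous
  refine lt_of_le_of_lt (eLpNorm_integral_le (volume.restrict (Ioc (0 : ℝ) 1))
    (le_trans (by norm_num) hp2) hp (fun s x => 2 * s ^ m * h (s ^ 2 • x)) ?_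
    (2 * eLpNorm h p volume) ?_) ?_
  · exact Continuous.aestronglyMeasurable (by fun_prop)
  · exact (ae_restrict_iff' measurableSet_Ioc).2
      (ae_of_all _ fun s hs => Bo_bound hp2 hp h hc hm hs)
  · exact ENNReal.mul_lt_top (measure_lt_top _ _) (ENNReal.mul_lt_top (by simp) hL.2)

lemma pd_Bo (j : Fin 3) (m : ℕ) (h : V3 → ℝ) (hh : Sm h) :
    pd j (Bo m h) = Bo (m + 2) (pd j h) := by
  ext x
  have hc := hh.continuous
  have hd := hh.continuous_fderiv (by simp)
  obtain ⟨C, hC⟩ := (isCompact_closedBall (0 : V3) (‖x‖ + 1)).exists_bound_of_continuousOn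
    hd.continuousOn
  have key := hasFDerivAt_integral_of_dominated_of_fderiv_le (𝕜 := ℝ)
    (μ := volume.restrict (Ioc (0 : ℝ) 1)) (F := fun x s => 2 * s ^ m * h (s ^ 2 • x))
    (F' := fun x s => (2 * s ^ m * s ^ 2) • fderiv ℝ h (s ^ 2 • x)) (x₀ := x)
    (s := Metric.ball x 1) (bound := fun _ => 2 * C)
    (Metric.ball_mem_nhds x one_pos) ?_ ?_ ?_ ?_ ?_ ?_
  · show fderiv ℝ (fun x => ∫ s in Ioc (0 : ℝ) 1, 2 * s ^ m * h (s ^ 2 • x)) x (Pi.single j 1) = _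
    rw [key.fderiv, ContinuousLinearMap.integral_apply, Bo]
    · congr 1; ext s
      simp only [smul_apply, smul_eq_mul, pd]
      ring
    · refine (Continuous.integrableOn_Icc ?_).mono_set Ioc_subset_Icc_self
      fun_prop
  · exact Eventually.of_forall fun y => Continuous.aestronglyMeasurable (by fun_prop)
  · refine (Continuous.integrableOn_Icc ?_).mono_set Ioc_subset_Icc_self
    fun_prop
  · exact Continuous.aestronglyMeasurable (by fun_prop)
  · refine (ae_restrict_iff' measurableSet_Ioc).2 (ae_of_all _ fun s hs y hy => ?_)
    have hs1 : s ^ 2 ≤ 1 := pow_le_one₀ hs.1.le hs.2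
    have hsm : s ^ m ≤ 1 := pow_le_one₀ hs.1.le hs.2
    have hs0 := hs.1
    have hy2 : ‖y‖ ≤ ‖x‖ + 1 := by
      have := mem_ball_iff_norm.1 hy
      have h2 := norm_le_norm_add_norm_sub' y x
      linarith
    have hb := hC (s ^ 2 • y) (by
      rw [mem_closedBall_zero_iff, norm_smul, Real.norm_of_nonneg (by positivity)]
      nlinarith [norm_nonneg y])
    rw [norm_smul, Real.norm_of_nonneg (by positivity)]
    have : 2 * s ^ m * s ^ 2 ≤ 2 := by
      have := mul_le_one₀ hsm (by positivity) hs1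
      linarith
    exact mul_le_mul this hb (norm_nonneg _) (by norm_num)
  · exact integrable_const _
  · refine ae_of_all _ fun s y _ => ?_
    have h1 : HasFDerivAt (fun y : V3 => s ^ 2 • y) (s ^ 2 • ContinuousLinearMap.id ℝ V3) y :=
      (hasFDerivAt_id y).const_smul (s ^ 2)
    have h2 := (((hh.diff (s ^ 2 • y)).hasFDerivAt.comp y h1).const_mul (2 * s ^ m))
    have e : (2 * s ^ m * s ^ 2) • fderiv ℝ h (s ^ 2 • y)
        = (2 * s ^ m) • (fderiv ℝ h (s ^ 2 • y)).comp (s ^ 2 • ContinuousLinearMap.id ℝ V3) := by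
      ext v
      simp; ring
    show HasFDerivAt (fun y : V3 => 2 * s ^ m * h (s ^ 2 • y))
      ((2 * s ^ m * s ^ 2) • fderiv ℝ h (s ^ 2 • y)) y
    rw [e]
    exact h2

lemma lap_Bo (m : ℕ) (h : V3 → ℝ) (hh : Sm h) : lap (Bo m h) = Bo (m + 4) (lap h) := by
  ext x
  have hpp : ∀ j, Sm (pd j (pd j h)) := fun j => pd_smooth j (pd_smooth j hh)
  have e1 : ∀ j, pd j (fun y => pd j (Bo m h) y) x = Bo (m + 4) (pd j (pd j h)) x := by
    intro j
    rw [pd_Bo j m h hh]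
    exact congrFun (pd_Bo j (m + 2) _ (pd_smooth j hh)) x
  have e2 : Bo (m + 4) (lap h) x
      = ∫ s in Ioc (0 : ℝ) 1, ∑ j, 2 * s ^ (m + 4) * pd j (pd j h) (s ^ 2 • x) := by
    rw [Bo]
    congr 1; ext s
    rw [← Finset.mul_sum]
    rfl
  rw [e2, integral_finsetSum]
  · exact Finset.sum_congr rfl fun j _ => e1 j
  · intro j _
    refine (Continuous.integrableOn_Icc ?_).mono_set Ioc_subset_Icc_self
    have := (hpp j).continuous
    fun_prop

lemma fderiv_eq_pd (h : V3 → ℝ) (y x : V3) : fderiv ℝ h y x = ∑ j, x j * pd j h y := by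
  conv_lhs => rw [pi_eq_sum_univ' x]
  rw [map_sum]
  refine Finset.sum_congr rfl fun j _ => ?_
  rw [map_smul, smul_eq_mul, pd]

lemma Bo_euler (h : V3 → ℝ) (hh : Sm h) (x : V3) :
    2 * Bo 3 h x + ∑ j, x j * pd j (Bo 3 h) x = h x := by
  have hc := hh.continuous
  have hd := hh.continuous_fderiv (by simp)
  have hpc : ∀ j, Continuous (pd j h) := fun j => (pd_smooth j hh).continuous
  have hI : ∀ F : ℝ → ℝ, Continuous F → Integrable F (volume.restrict (Ioc (0 : ℝ) 1)) :=
    fun F hF => (hF.integrableOn_Icc).mono_set Ioc_subset_Icc_self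
  have h1 : 2 * Bo 3 h x + ∑ j, x j * pd j (Bo 3 h) x
      = ∫ s in Ioc (0 : ℝ) 1, (4 * s ^ 3 * h (s ^ 2 • x)
        + s ^ 4 * fderiv ℝ h (s ^ 2 • x) ((2 * s) • x)) := by
    have e1 : ∀ j, pd j (Bo 3 h) x = Bo 5 (pd j h) x := fun j => congrFun (pd_Bo j 3 h hh) x
    simp only [e1, Bo]
    simp only [← integral_const_mul]
    rw [← integral_finsetSum _ (fun j _ => hI _ (by have := hpc j; fun_prop)), ← integral_add]
    · congr 1; ext s
      rw [fderiv_eq_pd]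
      simp only [Fin.sum_univ_three, Pi.smul_apply, smul_eq_mul]
      ring
    · exact hI _ (by fun_prop)
    · exact hI _ (by fun_prop)
  rw [h1, ← intervalIntegral.integral_of_le zero_le_one,
    intervalIntegral.integral_eq_sub_of_hasDerivAt (f := fun s => s ^ 4 * h (s ^ 2 • x))]
  · simp
  · intro s _
    have g1 : HasDerivAt (fun s : ℝ => s ^ 2 • x) ((2 * s) • x) s := by
      have := (hasDerivAt_pow 2 s).smul_const x
      simpa using this
    have g2 := (hh.diff (s ^ 2 • x)).hasFDerivAt.comp_hasDerivAt s g1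
    have g3 := (hasDerivAt_pow 4 s).mul g2
    exact g3.congr_deriv (by simp)
  · exact Continuous.intervalIntegrable (by fun_prop) _ _


/-- scalar version of `L` -/
def So (h : V3 → ℝ) (x : V3) : ℝ := lap h x + (∑ j, x j / 2 * pd j h x) + h x / 2

/-- continuous sequence tending to zero in `L^p` -/
def Cz (p : ENNReal) (w : ℕ → V3 → ℝ) : Prop :=
  (∀ n, Continuous (w n)) ∧ Tendsto (fun n => eLpNorm (w n) p volume) atTop (𝓝 0)

lemma Cz.add {p : ENNReal} (hp1 : 1 ≤ p) {u v : ℕ → V3 → ℝ} (hu : Cz p u) (hv : Cz p v) :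
    Cz p (fun n x => u n x + v n x) := by
  refine ⟨fun n => (hu.1 n).add (hv.1 n), ?_⟩
  have h := hu.2.add hv.2
  rw [add_zero] at h
  exact tendsto_of_tendsto_of_tendsto_of_le_of_le tendsto_const_nhds h (fun n => zero_le)
    (fun n => eLpNorm_add_le (hu.1 n).aestronglyMeasurable (hv.1 n).aestronglyMeasurable hp1)

lemma Cz.sub {p : ENNReal} (hp1 : 1 ≤ p) {u v : ℕ → V3 → ℝ} (hu : Cz p u) (hv : Cz p v) :
    Cz p (fun n x => u n x - v n x) := by
  refine ⟨fun n => (hu.1 n).sub (hv.1 n), ?_⟩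
  have h := hu.2.add hv.2
  rw [add_zero] at h
  exact tendsto_of_tendsto_of_tendsto_of_le_of_le tendsto_const_nhds h (fun n => zero_le)
    (fun n => eLpNorm_sub_le (hu.1 n).aestronglyMeasurable (hv.1 n).aestronglyMeasurable hp1)

lemma Cz.sum {p : ENNReal} (hp1 : 1 ≤ p) {u : Fin 3 → ℕ → V3 → ℝ} (hu : ∀ j, Cz p (u j)) :
    Cz p (fun n x => ∑ j, u j n x) := by
  simp only [Fin.sum_univ_three]
  exact ((hu 0).add hp1 (hu 1)).add hp1 (hu 2)

/-- scaling parameter -/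
def en (n : ℕ) : ℝ := ((n : ℝ) + 1)⁻¹

lemma en_pos (n : ℕ) : 0 < en n := by unfold en; positivity
lemma en_le (n : ℕ) : en n ≤ 1 := by
  unfold en; exact inv_le_one_of_one_le₀ (by linarith [Nat.cast_nonneg (α := ℝ) n])
lemma en_lim : Tendsto en atTop (𝓝 0) := by
  have := tendsto_one_div_add_atTop_nhds_zero_nat (𝕜 := ℝ)
  show Tendsto (fun n => en n) atTop (𝓝 0)
  simpa [en, one_div] using this

lemma cz_cut {p : ENNReal} (hp1 : 1 ≤ p) (hp : p ≠ ⊤) {η h : V3 → ℝ} (hη : TestS η)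
    (hc : Continuous h) (hh : MemLp h p volume) :
    Cz p (fun n x => (η (en n • x) - η 0) * h x) := by
  have hηc := hη.1.continuous
  refine ⟨fun n => by fun_prop, ?_⟩
  obtain ⟨C, hC⟩ := cs_bound η hη.1.continuous hη.2
  refine tendsto_mul_dom hp1 hp (fun n x => η (en n • x) - η 0) (2 * C) (fun n => by fun_prop)
    (fun n x => ?_) (fun x => ?_) h hh
  · have := abs_sub (η (en n • x)) (η 0)
    have h1 := hC (en n • x)
    have h2 := hC 0
    linarith
  · have h1 : Tendsto (fun n => en n • x) atTop (𝓝 0) := by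
      simpa using en_lim.smul_const x
    simpa using ((hηc.tendsto 0).comp h1).sub_const (η 0)

lemma cz_small {p : ENNReal} (hp1 : 1 ≤ p) (hp : p ≠ ⊤) {η h : V3 → ℝ} (hη : TestS η)
    (hc : Continuous h) (hh : MemLp h p volume) (c : ℕ → ℝ) (hc1 : ∀ n, |c n| ≤ 2)
    (hc0 : Tendsto c atTop (𝓝 0)) :
    Cz p (fun n x => (c n * η (en n • x)) * h x) := by
  have hηc := hη.1.continuous
  refine ⟨fun n => by fun_prop, ?_⟩
  obtain ⟨C, hC⟩ := cs_bound η hη.1.continuous hη.2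
  refine tendsto_mul_dom hp1 hp (fun n x => c n * η (en n • x)) (2 * C) (fun n => by fun_prop)
    (fun n x => ?_) (fun x => ?_) h hh
  · rw [abs_mul]
    exact mul_le_mul (hc1 n) (hC _) (abs_nonneg _) (by norm_num)
  · have h1 : Tendsto (fun n => en n • x) atTop (𝓝 0) := by
      simpa using en_lim.smul_const x
    simpa using hc0.mul ((hηc.tendsto 0).comp h1)

lemma lap_smooth {h : V3 → ℝ} (hh : Sm h) : Sm (lap h) :=
  ContDiff.sum fun j _ => pd_smooth j (pd_smooth j hh)

lemma So_smooth {h : V3 → ℝ} (hh : Sm h) : Sm (So h) :=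
  ((lap_smooth hh).add (ContDiff.sum fun j _ => (sm_coordh j).mul (pd_smooth j hh))).add
    (hh.div_const 2)

lemma So_add {f g : V3 → ℝ} (hf : Sm f) (hg : Sm g) (x : V3) :
    So (fun y => f y + g y) x = So f x + So g x := by
  have e1 : ∀ j, pd j (fun y => f y + g y) = fun y => pd j f y + pd j g y := fun j => by
    ext y; exact pd_add j hf hg y
  simp only [So, lap, e1, fun j => pd_add j (pd_smooth j hf) (pd_smooth j hg) x,
    Fin.sum_univ_three]
  ring

lemma So_sub {f g : V3 → ℝ} (hf : Sm f) (hg : Sm g) (x : V3) :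
    So (fun y => f y - g y) x = So f x - So g x := by
  have e1 : ∀ j, pd j (fun y => f y - g y) = fun y => pd j f y - pd j g y := fun j => by
    ext y; exact pd_sub j hf hg y
  simp only [So, lap, e1, fun j => pd_sub j (pd_smooth j hf) (pd_smooth j hg) x,
    Fin.sum_univ_three]
  ring

lemma So_sum {f : Fin 3 → V3 → ℝ} (hf : ∀ i, Sm (f i)) (x : V3) :
    So (fun y => ∑ i, f i y) x = ∑ i, So (f i) x := by
  simp only [Fin.sum_univ_three]
  rw [So_add ((hf 0).add (hf 1)) (hf 2), So_add (hf 0) (hf 1)]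

lemma So_cut {η h : V3 → ℝ} (hη : Sm η) (hh : Sm h) (e : ℝ) (x : V3) :
    So (fun y => η (e • y) * h y) x = η (e • x) * So h x
      + (∑ j, (2 * e * pd j η (e • x)) * pd j h x)
      + (e ^ 2 * lap η (e • x)) * h x
      + (∑ j, (e • x) j / 2 * pd j η (e • x)) * h x := by
  have e1 : ∀ j, pd j (fun y => η (e • y) * h y)
      = fun y => (e * pd j η (e • y)) * h y + η (e • y) * pd j h y := fun j => by
    ext y
    rw [pd_mul j (sm_smul e hη) hh, pd_smul]
  have s1 : ∀ j, Sm (fun y => e * pd j η (e • y)) := fun j =>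
    contDiff_const.mul (sm_smul e (pd_smooth j hη))
  have e2 : ∀ j, pd j (fun y => (e * pd j η (e • y)) * h y + η (e • y) * pd j h y) x
      = e ^ 2 * pd j (pd j η) (e • x) * h x + 2 * e * pd j η (e • x) * pd j h x
        + η (e • x) * pd j (pd j h) x := fun j => by
    rw [pd_add j ((s1 j).mul hh) ((sm_smul e hη).mul (pd_smooth j hh)),
      pd_mul j (s1 j) hh, pd_mul j (sm_smul e hη) (pd_smooth j hh),
      pd_const_mul j e (sm_smul e (pd_smooth j hη)), pd_smul, pd_smul]
    ring
  simp only [So, lap, e1, e2, Fin.sum_univ_three, Pi.smul_apply, smul_eq_mul]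
  ring

lemma trunc {p : ENNReal} (hp1 : 1 ≤ p) (hp : p ≠ ⊤) {η h : V3 → ℝ} (hη : TestS η) (hh : Sm h)
    (h0 : MemLp h p volume) (h1 : ∀ j, MemLp (pd j h) p volume) (hS : MemLp (So h) p volume) :
    Cz p (fun n x => η (en n • x) * h x - η 0 * h x) ∧
    Cz p (fun n x => So (fun y => η (en n • y) * h y) x - η 0 * So h x) := by
  have hlap : TestS (lap η) := test_sum fun j => pd_test j (pd_test j hη)
  have hz : TestS (fun y => ∑ j, y j / 2 * pd j η y) :=
    test_sum fun j => test_mul (sm_coordh j) (pd_test j hη)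
  constructor
  · have := cz_cut hp1 hp hη hh.continuous h0
    simpa only [sub_mul] using this
  · have t1 := cz_cut hp1 hp hη (So_smooth hh).continuous hS
    have t2 := Cz.sum hp1 fun j => cz_small hp1 hp (pd_test j hη) (pd_smooth j hh).continuous (h1 j)
      (fun n => 2 * en n) (fun n => by
        rw [abs_of_pos (by linarith [en_pos n])]; linarith [en_le n])
      (by simpa using en_lim.const_mul 2)
    have t3 := cz_small hp1 hp hlap hh.continuous h0
      (fun n => en n ^ 2) (fun n => by
        rw [abs_of_pos (by have := en_pos n; positivity)]; nlinarith [en_le n, en_pos n])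
      (by simpa using en_lim.pow 2)
    have t4 := cz_cut hp1 hp hz hh.continuous h0
    have := ((t1.add hp1 t2).add hp1 t3).add hp1 t4
    convert this using 3 with n x
    rw [So_cut hη.1 hh]
    simp
    ring

/-- the truncated field -/
def Tr (χ : V3 → ℝ) (f b : Fin 3 → V3 → ℝ) (e : ℝ) : VF := fun x i =>
  (χ (e • x) * f i x + (∑ k, (e • x) k * pd k χ (e • x)) * b i x)
    - ∑ j, ((e • x) i * pd j χ (e • x)) * b j x

lemma Tr_test {χ : V3 → ℝ} (hχ : TestS χ) {f b : Fin 3 → V3 → ℝ} (hf : ∀ i, Sm (f i))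
    (hb : ∀ i, Sm (b i)) {e : ℝ} (he : e ≠ 0) (i : Fin 3) : TestS (fun x => Tr χ f b e x i) := by
  have hZ : TestS (fun y => ∑ k, y k * pd k χ y) :=
    test_sum fun j => test_mul (sm_coord j) (pd_test j hχ)
  have hN : ∀ j, TestS (fun y => y i * pd j χ y) := fun j =>
    test_mul (sm_coord i) (pd_test j hχ)
  have t1 := test_mul (hf i) (test_smul e he hχ)
  have t2 := test_mul (hb i) (test_smul e he hZ)
  have t3 := test_sum fun j => test_mul (hb j) (test_smul e he (hN j))
  have := test_add (test_add t1 t2) (test_cmul (-1) t3)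
  convert this using 2 with x
  simp only [Tr, Fin.sum_univ_three]
  ring

lemma Tr_div {χ : V3 → ℝ} (hχ : Sm χ) {f b : Fin 3 → V3 → ℝ} (hf : ∀ i, Sm (f i))
    (hb : ∀ i, Sm (b i)) (hdf : ∀ x, ∑ i, pd i (f i) x = 0) (hdb : ∀ x, ∑ i, pd i (b i) x = 0)
    (hE : ∀ i x, 2 * b i x + ∑ j, x j * pd j (b i) x = f i x) (e : ℝ) :
    DivFreePt (Tr χ f b e) := by
  intro x
  have sN : ∀ i j, Sm (fun y => y i * pd j χ y) := fun i j => (sm_coord i).mul (pd_smooth j hχ)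
  have sZ : Sm (fun y => ∑ k, y k * pd k χ y) := ContDiff.sum fun k _ => sN k k
  have key : ∀ i, pdv i (Tr χ f b e) i x
      = (e * pd i χ (e • x) * f i x + χ (e • x) * pd i (f i) x
        + (e * (pd i χ (e • x) + ∑ k, (e • x) k * pd i (pd k χ) (e • x)) * b i x
          + (∑ k, (e • x) k * pd k χ (e • x)) * pd i (b i) x))
        - ∑ j, (e * (pd j χ (e • x) + (e • x) i * pd i (pd j χ) (e • x)) * b j x
          + (e • x) i * pd j χ (e • x) * pd i (b j) x) := by
    intro i
    have u1 : Sm (fun y => χ (e • y) * f i y) := (sm_smul e hχ).mul (hf i)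
    have u2 : Sm (fun y => (∑ k, (e • y) k * pd k χ (e • y)) * b i y) :=
      (sm_smul e sZ).mul (hb i)
    have u3 : ∀ j, Sm (fun y => ((e • y) i * pd j χ (e • y)) * b j y) := fun j =>
      (sm_smul e (sN i j)).mul (hb j)
    have d1 : pd i (fun y => χ (e • y) * f i y) x
        = e * pd i χ (e • x) * f i x + χ (e • x) * pd i (f i) x := by
      rw [pd_mul i (sm_smul e hχ) (hf i), pd_smul]
    have d2 : pd i (fun y => (∑ k, (e • y) k * pd k χ (e • y)) * b i y) x
        = e * (pd i χ (e • x) + ∑ k, (e • x) k * pd i (pd k χ) (e • x)) * b i x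
          + (∑ k, (e • x) k * pd k χ (e • x)) * pd i (b i) x := by
      rw [pd_mul i (sm_smul e sZ) (hb i), pd_smul i e (fun y => ∑ k, y k * pd k χ y),
        pd_sum i (fun k => sN k k)]
      congr 3
      simp only [fun k => pd_mul i (sm_coord k) (pd_smooth k hχ) (e • x), pd_coord]
      rw [Finset.sum_add_distrib]
      simp
    have d3 : ∀ j, pd i (fun y => ((e • y) i * pd j χ (e • y)) * b j y) x
        = e * (pd j χ (e • x) + (e • x) i * pd i (pd j χ) (e • x)) * b j x
          + (e • x) i * pd j χ (e • x) * pd i (b j) x := by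
      intro j
      rw [pd_mul i (sm_smul e (sN i j)) (hb j), pd_smul i e (fun y => y i * pd j χ y),
        pd_mul i (sm_coord i) (pd_smooth j hχ), pd_coord]
      simp
    show pd i (fun y => (χ (e • y) * f i y + (∑ k, (e • y) k * pd k χ (e • y)) * b i y)
      - ∑ j, ((e • y) i * pd j χ (e • y)) * b j y) x = _
    rw [pd_sub i (u1.add u2) (ContDiff.sum fun j _ => u3 j), pd_add i u1 u2, pd_sum i u3, d1, d2]
    simp only [d3]
  simp only [key]
  have c01 := pd_comm 0 1 hχ (e • x)
  have c02 := pd_comm 0 2 hχ (e • x)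
  have c12 := pd_comm 1 2 hχ (e • x)
  have hdf := hdf x
  have hdb := hdb x
  have E0 := hE 0 x
  have E1 := hE 1 x
  have E2 := hE 2 x
  simp only [Fin.sum_univ_three, Pi.smul_apply, smul_eq_mul] at *
  rw [c01, c02, c12, ← E0, ← E1, ← E2]
  linear_combination χ (e • x) * hdf
    + (e * x 0 * pd 0 χ (e • x) + e * x 1 * pd 1 χ (e • x) + e * x 2 * pd 2 χ (e • x)) * hdb

lemma Tr_conv {p : ENNReal} (hp1 : 1 ≤ p) (hp : p ≠ ⊤) {χ : V3 → ℝ} (hχ : TestS χ) (hχ0 : χ 0 = 1)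
    {f b : Fin 3 → V3 → ℝ} (hf : ∀ i, Sm (f i)) (hb : ∀ i, Sm (b i))
    (f0 : ∀ i, MemLp (f i) p volume) (f1 : ∀ i j, MemLp (pd j (f i)) p volume)
    (fS : ∀ i, MemLp (So (f i)) p volume)
    (b0 : ∀ i, MemLp (b i) p volume) (b1 : ∀ i j, MemLp (pd j (b i)) p volume)
    (bS : ∀ i, MemLp (So (b i)) p volume) (i : Fin 3) :
    Cz p (fun n x => Tr χ f b (en n) x i - f i x) ∧
    Cz p (fun n x => Lcl (Tr χ f b (en n)) x i - So (f i) x) := by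
  have hZ : TestS (fun y => ∑ k, y k * pd k χ y) :=
    test_sum fun j => test_mul (sm_coord j) (pd_test j hχ)
  have hN : ∀ j, TestS (fun y => y i * pd j χ y) := fun j =>
    test_mul (sm_coord i) (pd_test j hχ)
  have t1 := trunc hp1 hp hχ (hf i) (f0 i) (f1 i) (fS i)
  have t2 := trunc hp1 hp hZ (hb i) (b0 i) (b1 i) (bS i)
  have t3 := fun j => trunc hp1 hp (hN j) (hb j) (b0 j) (b1 j) (bS j)
  constructor
  · have := (t1.1.add hp1 t2.1).sub hp1 (Cz.sum hp1 fun j => (t3 j).1)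
    convert this using 3 with n x
    simp [Tr, hχ0]
    ring
  · have := (t1.2.add hp1 t2.2).sub hp1 (Cz.sum hp1 fun j => (t3 j).2)
    convert this using 3 with n x
    have e : Lcl (Tr χ f b (en n)) x i = So (fun y =>
      (χ (en n • y) * f i y + (∑ k, (en n • y) k * pd k χ (en n • y)) * b i y)
        - ∑ j, ((en n • y) i * pd j χ (en n • y)) * b j y) x := rfl
    have u1 : Sm (fun y => χ (en n • y) * f i y) := (sm_smul _ hχ.1).mul (hf i)
    have u2 : Sm (fun y => (∑ k, (en n • y) k * pd k χ (en n • y)) * b i y) :=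
      (sm_smul _ hZ.1).mul (hb i)
    have u3 : ∀ j, Sm (fun y => ((en n • y) i * pd j χ (en n • y)) * b j y) := fun j =>
      (sm_smul _ (hN j).1).mul (hb j)
    rw [e, So_sub (u1.add u2) (ContDiff.sum fun j _ => u3 j), So_add u1 u2, So_sum u3]
    simp [hχ0]
    ring

lemma test_schwartz {ψ : VF} (h : ∀ i, TestS (fun x => ψ x i)) : IsSchwartz ψ := by
  have h1 : ContDiff ℝ (⊤ : ℕ∞) ψ := contDiff_pi.2 fun i => (h i).1
  have h2 : HasCompactSupport ψ := by
    refine HasCompactSupport.intro (K := ⋃ i, tsupport (fun x => ψ x i))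
      (isCompact_iUnion fun i => (h i).2) fun x hx => ?_
    ext i
    exact image_eq_zero_of_notMem_tsupport (f := fun x => ψ x i) fun hi =>
      hx (mem_iUnion.2 ⟨i, hi⟩)
  exact ⟨h1, fun k n => (h2.toSchwartzMap h1).decay' k n⟩

lemma vec_bound {p : ENNReal} (hp1 : 1 ≤ p) {u : VF}
    (hu : ∀ i, AEStronglyMeasurable (fun x => u x i) volume) {δ : ENNReal}
    (h : ∀ i, eLpNorm (fun x => u x i) p volume ≤ δ) : eLpNorm u p volume ≤ 3 * δ := by
  calc eLpNorm u p volume ≤ eLpNorm (fun x => ∑ i, ‖u x i‖) p volume := by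
        refine eLpNorm_mono_real fun x => ?_
        refine (pi_norm_le_iff_of_nonneg (Finset.sum_nonneg fun i _ => norm_nonneg _)).2 fun i => ?_
        exact Finset.single_le_sum (f := fun i => ‖u x i‖) (fun i _ => norm_nonneg _)
          (Finset.mem_univ i)
    _ = eLpNorm (∑ i, fun x => ‖u x i‖) p volume := by
        congr 1
    _ ≤ ∑ i, eLpNorm (fun x => ‖u x i‖) p volume :=
        eLpNorm_sum_le (fun i _ => (hu i).norm) hp1
    _ ≤ ∑ i : Fin 3, δ := Finset.sum_le_sum fun i _ => by rw [eLpNorm_norm]; exact h i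
    _ = 3 * δ := by simp


lemma Bo_div {F : Fin 3 → V3 → ℝ} (hF : ∀ i, Sm (F i)) (hd : ∀ x, ∑ i, pd i (F i) x = 0) (x : V3) :
    ∑ i, pd i (Bo 3 (F i)) x = 0 := by
  have e1 : ∀ i, pd i (Bo 3 (F i)) x = Bo 5 (pd i (F i)) x := fun i =>
    congrFun (pd_Bo i 3 _ (hF i)) x
  simp only [e1]
  simp only [Bo]
  rw [← integral_finsetSum]
  · simp only [← Finset.mul_sum, hd, mul_zero, integral_zero]
  · intro j _
    refine (Continuous.integrableOn_Icc ?_).mono_set Ioc_subset_Icc_self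
    have := (pd_smooth j (hF j)).continuous
    fun_prop

lemma So_Bo {h : V3 → ℝ} (hh : Sm h) :
    So (Bo 3 h) = fun x => Bo 7 (lap h) x + ((1 / 2 : ℝ) * h x + (-(1 / 2) : ℝ) * Bo 3 h x) := by
  ext x
  have e := Bo_euler h hh x
  have l := congrFun (lap_Bo 3 h hh) x
  simp only [So, l, Fin.sum_univ_three] at *
  linear_combination e / 2

lemma approx (φ g : VF) (hφ : InX φ) (hg : MemL24 g) (hLg : IsLof φ g) {δ : ENNReal} (hδ : 0 < δ) :
    ∃ ψ : VF, IsSchwartz ψ ∧ DivFreePt ψ ∧ ∀ p : ENNReal, (p = 2 ∨ p = 4) →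
      eLpNorm (fun x i => ψ x i - φ x i) p volume ≤ 3 * (δ + δ) ∧
      eLpNorm (fun x i => Lcl ψ x i - g x i) p volume ≤ 3 * (δ + δ) := by
  obtain ⟨f, fs, fd, hf⟩ := mollify φ g hφ hg hLg hδ
  let F : Fin 3 → V3 → ℝ := fun i x => f x i
  let b : Fin 3 → V3 → ℝ := fun i => Bo 3 (F i)
  have hb : ∀ i, Sm (b i) := fun i => Bo_smooth 3 _ (fs i)
  let B : ContDiffBump (0 : V3) := ⟨1, 2, by norm_num, by norm_num⟩
  have hχ : TestS B := ⟨B.contDiff, B.hasCompactSupport⟩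
  have hχ0 : B 0 = 1 := B.one_of_mem_closedBall (by simp [B])
  have conv : ∀ p : ENNReal, (p = 2 ∨ p = 4) → ∀ i,
      Cz p (fun n x => Tr B F b (en n) x i - F i x) ∧
      Cz p (fun n x => Lcl (Tr B F b (en n)) x i - So (F i) x) := by
    intro p hp
    have hp2 : 2 ≤ p := by rcases hp with rfl | rfl <;> norm_num
    have hpt : p ≠ ⊤ := by rcases hp with rfl | rfl <;> simp
    have hp1 : 1 ≤ p := le_trans (by norm_num) hp2
    have H := hf p hp
    have b0 : ∀ i, MemLp (b i) p volume := fun i => Bo_memLp hp2 hpt _ (fs i) (H i).1 le_rfl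
    refine Tr_conv hp1 hpt hχ hχ0 fs hb (fun i => (H i).1) (fun i j => (H i).2.1 j)
      (fun i => (H i).2.2.2.1) b0 (fun i j => ?_) (fun i => ?_)
    · have e : pd j (b i) = Bo 5 (pd j (F i)) := pd_Bo j 3 _ (fs i)
      rw [e]
      exact Bo_memLp hp2 hpt _ (pd_smooth j (fs i)) ((H i).2.1 j) (by norm_num)
    · have e : So (b i) = _ := So_Bo (fs i)
      rw [e]
      exact (Bo_memLp hp2 hpt _ (lap_smooth (fs i)) (H i).2.2.1 (by norm_num)).add
        (((H i).1.const_mul _).add ((b0 i).const_mul _))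
  have ev : ∀ p : ENNReal, (p = 2 ∨ p = 4) → ∀ᶠ n in atTop, ∀ i,
      eLpNorm (fun x => Tr B F b (en n) x i - F i x) p volume ≤ δ ∧
      eLpNorm (fun x => Lcl (Tr B F b (en n)) x i - So (F i) x) p volume ≤ δ := by
    intro p hp
    rw [eventually_all]
    intro i
    exact ((conv p hp i).1.2.eventually_le_const hδ).and ((conv p hp i).2.2.eventually_le_const hδ)
  obtain ⟨n, h2, h4⟩ := ((ev 2 (Or.inl rfl)).and (ev 4 (Or.inr rfl))).exists
  refine ⟨Tr B F b (en n), test_schwartz fun i => Tr_test hχ fs hb (en_pos n).ne' i,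
    Tr_div hχ.1 fs hb fd (Bo_div fs fd) (fun i x => Bo_euler _ (fs i) x) _, fun p hp => ?_⟩
  have hn : ∀ i, eLpNorm (fun x => Tr B F b (en n) x i - F i x) p volume ≤ δ ∧
      eLpNorm (fun x => Lcl (Tr B F b (en n)) x i - So (F i) x) p volume ≤ δ := by
    rcases hp with rfl | rfl
    · exact h2
    · exact h4
  have hp1 : 1 ≤ p := by rcases hp with rfl | rfl <;> norm_num
  have hφp : MemLp φ p volume := by
    rcases hp with rfl | rfl
    · exact hφ.1.1
    · exact hφ.1.2
  have hgp : MemLp g p volume := by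
    rcases hp with rfl | rfl
    · exact hg.1
    · exact hg.2
  have m1 : ∀ i, AEStronglyMeasurable (fun x => Tr B F b (en n) x i - F i x) volume := fun i =>
    ((conv p hp i).1.1 n).aestronglyMeasurable
  have m2 : ∀ i, AEStronglyMeasurable (fun x => Lcl (Tr B F b (en n)) x i - So (F i) x) volume :=
    fun i => ((conv p hp i).2.1 n).aestronglyMeasurable
  have m3 : ∀ i, AEStronglyMeasurable (fun x => F i x - φ x i) volume := fun i =>
    (fs i).continuous.aestronglyMeasurable.sub (comp_memLp hφp i).1
  have m4 : ∀ i, AEStronglyMeasurable (fun x => So (F i) x - g x i) volume := fun i =>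
    (So_smooth (fs i)).continuous.aestronglyMeasurable.sub (comp_memLp hgp i).1
  have s1 : ∀ i, (fun x => Tr B F b (en n) x i - φ x i)
      = (fun x => Tr B F b (en n) x i - F i x) + (fun x => F i x - φ x i) := fun i => by
    ext x; simp
  have s2 : ∀ i, (fun x => Lcl (Tr B F b (en n)) x i - g x i)
      = (fun x => Lcl (Tr B F b (en n)) x i - So (F i) x) + (fun x => So (F i) x - g x i) :=
    fun i => by ext x; simp
  constructor
  · refine vec_bound hp1 (fun i => ?_) (fun i => ?_)
    · rw [s1 i]; exact (m1 i).add (m3 i)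
    · rw [s1 i]
      exact (eLpNorm_add_le (m1 i) (m3 i) hp1).trans
        (add_le_add (hn i).1 (hf p hp i).2.2.2.2.1)
  · refine vec_bound hp1 (fun i => ?_) (fun i => ?_)
    · rw [s2 i]; exact (m2 i).add (m4 i)
    · rw [s2 i]
      exact (eLpNorm_add_le (m2 i) (m4 i) hp1).trans
        (add_le_add (hn i).2 (hf p hp i).2.2.2.2.2)

lemma Xnorm_small {u : VF} {e : ℝ} (he : 0 < e)
    (h : ∀ p : ENNReal, (p = 2 ∨ p = 4) → eLpNorm u p volume
      ≤ 3 * (ENNReal.ofReal e + ENNReal.ofReal e)) : Xnorm u ≤ 12 * e := by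
  have h1 : ∀ p : ENNReal, (p = 2 ∨ p = 4) → (eLpNorm u p volume).toReal ≤ 6 * e := by
    intro p hp
    refine ENNReal.toReal_le_of_le_ofReal (by positivity) ((h p hp).trans ?_)
    rw [← ENNReal.ofReal_add he.le he.le, show (3 : ENNReal) = ENNReal.ofReal 3 by simp,
      ← ENNReal.ofReal_mul (by norm_num)]
    exact ENNReal.ofReal_le_ofReal (by linarith)
  have := h1 2 (Or.inl rfl)
  have := h1 4 (Or.inr rfl)
  unfold Xnorm
  linarith

lemma Xnorm_nonneg (u : VF) : 0 ≤ Xnorm u := by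
  unfold Xnorm; positivity

/-- divergence free Schwartz fields are dense in `D` for the graph norm
`‖Lφ‖_X`; in particular `φₙ → φ` in `X`. -/
theorem stmt1 (φ g : VF) (hφ : InD φ) (hg : MemL24 g) (hLg : IsLof φ g) :
    ∃ φn : ℕ → VF, (∀ n, IsSchwartz (φn n) ∧ DivFreePt (φn n)) ∧
      Tendsto (fun n => Xnorm (fun x i => Lcl (φn n) x i - g x i)) atTop (nhds 0) ∧
      Tendsto (fun n => Xnorm (fun x i => φn n x i - φ x i)) atTop (nhds 0) := by

  choose ψ h1 h2 h3 using fun n : ℕ => approx φ g hφ.1 hg hLg (δ := ENNReal.ofReal (en n))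
    (ENNReal.ofReal_pos.2 (en_pos n))
  have hl : Tendsto (fun n => 12 * en n) atTop (nhds 0) := by
    simpa using en_lim.const_mul 12
  refine ⟨ψ, fun n => ⟨h1 n, h2 n⟩, ?_, ?_⟩
  · exact tendsto_of_tendsto_of_tendsto_of_le_of_le tendsto_const_nhds hl
      (fun n => Xnorm_nonneg _) (fun n => Xnorm_small (en_pos n) fun p hp => (h3 n p hp).2)
  · exact tendsto_of_tendsto_of_tendsto_of_le_of_le tendsto_const_nhds hl
      (fun n => Xnorm_nonneg _) (fun n => Xnorm_small (en_pos n) fun p hp => (h3 n p hp).1)
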